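/- Fix a prime p. If Aschbacher's conjecture at p holds for all instances in which the elementary abelian p-subgroup A has rank exactly 3, then it holds for all instances of rank r ≥ 3. Moreover, if for a fixed nonabelian simple group L of order prime to p the conjecture holds in all rank-3 instances whose simple component is L, then it holds in every rank r ≥ 3 instance whose simple component is L. -/

import Mathlib

open Function

/-- The geometric realization of the order complex of the subposet `S` of `X`,
realized as a subspace of `X → ℝ`: convex combinations supported on finite
nonempty chains contained in `S`. -/
def geomRealOn {X : Type*} [Preorder X] (S : Set X) : Set (X → ℝ) :=
  {f | (∀ x, 0 ≤ f x) ∧ Function.support f ⊆ S ∧ IsChain (· ≤ ·) (Function.support f) ∧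
    ∃ s : Finset X, Function.support f ⊆ ↑s ∧ ∑ x ∈ s, f x = 1}

/-- A group is elementary abelian for the prime `p` if it is abelian and
every element has order dividing `p`. -/
def IsElementaryAbelian (p : ℕ) (G : Type*) [Group G] : Prop :=
  (∀ a b : G, a * b = b * a) ∧ ∀ a : G, a ^ p = 1

/-- The Quillen poset `A_p(G)`: nontrivial elementary abelian `p`-subgroups of `G`. -/
def apSet (p : ℕ) (G : Type*) [Group G] : Set (Subgroup G) :=
  {H | H ≠ ⊥ ∧ IsElementaryAbelian p ↥H}

/-- `Ω₁(G)`: the subgroup generated by the elements of order `p`. -/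
def omega1 (p : ℕ) (G : Type*) [Group G] : Subgroup G :=
  Subgroup.closure {x : G | orderOf x = p}

/-- A group is almost simple if it has a nonabelian simple normal subgroup
with trivial centralizer. -/
def IsAlmostSimple (H : Type*) [Group H] : Prop :=
  ∃ L : Subgroup H, L.Normal ∧ IsSimpleGroup ↥L ∧ (∃ a b : ↥L, a * b ≠ b * a) ∧
    Subgroup.centralizer (L : Set H) = ⊥

/-- The conjugate subgroup `g L g⁻¹`. -/
def conjSub {H : Type*} [Group H] (g : H) (L : Subgroup H) : Subgroup H :=
  L.map ((MulAut.conj g).toMonoidHom)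

/-- `L` is a subnormal subgroup. -/
def IsSubnormal {H : Type*} [Group H] (L : Subgroup H) : Prop :=
  ∃ (n : ℕ) (c : ℕ → Subgroup H), c 0 = L ∧ c n = ⊤ ∧
    ∀ i < n, c i ≤ c (i + 1) ∧ ∀ g ∈ c (i + 1), ∀ x ∈ c i, g * x * g⁻¹ ∈ c i

/-- `N` is the internal direct product of the `A`-conjugates of `L`. -/
def IsDirectProdOfConjugates {H : Type*} [Group H] (A N L : Subgroup H) : Prop :=
  (⨆ (K : Subgroup H) (_ : ∃ a ∈ A, K = conjSub a L), K) = N ∧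
  (∀ K K' : Subgroup H, (∃ a ∈ A, K = conjSub a L) → (∃ a ∈ A, K' = conjSub a L) → K ≠ K' →
    ∀ x ∈ K, ∀ y ∈ K', x * y = y * x) ∧
  (∀ K : Subgroup H, (∃ a ∈ A, K = conjSub a L) →
    K ⊓ (⨆ (K' : Subgroup H) (_ : (∃ a ∈ A, K' = conjSub a L) ∧ K' ≠ K), K') = ⊥)

/-- The hypotheses of Aschbacher's conjecture (without the rank condition). -/
def AschbacherCore (p : ℕ) {H : Type*} [Group H] (A N L : Subgroup H) : Prop :=
  IsElementaryAbelian p ↥A ∧ N.Normal ∧ Subgroup.centralizer (N : Set H) = ⊥ ∧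
    A ⊔ N = ⊤ ∧ L ≤ N ∧ IsSubnormal L ∧ IsSimpleGroup ↥L ∧ (∃ a b : ↥L, a * b ≠ b * a) ∧
    ¬ p ∣ Nat.card ↥L ∧ IsDirectProdOfConjugates A N L


/-- Aschbacher's conjecture at `p`, restricted to instances whose rank satisfies `R`. -/
def AschbacherConjectureRank (p : ℕ) (R : ℕ → Prop) : Prop :=
  ∀ (H : Type) [Group H] [Finite H] (A N L : Subgroup H),
    AschbacherCore p A N L → (∃ r : ℕ, 3 ≤ r ∧ R r ∧ Nat.card ↥A = p ^ r) →
    SimplyConnectedSpace ↥(geomRealOn (apSet p H))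

/-- Aschbacher's conjecture at `p`, restricted to instances whose rank satisfies `R`
and whose simple component is isomorphic to the fixed group `L₀`. -/
def AschbacherConjectureRankFor (p : ℕ) (R : ℕ → Prop) (L₀ : Type) [Group L₀] : Prop :=
  ∀ (H : Type) [Group H] [Finite H] (A N L : Subgroup H),
    AschbacherCore p A N L → Nonempty (↥L ≃* L₀) →
    (∃ r : ℕ, 3 ≤ r ∧ R r ∧ Nat.card ↥A = p ^ r) →
    SimplyConnectedSpace ↥(geomRealOn (apSet p H))

section OrderComplex

open Classical in
/-- The barycenter of a finite set of vertices. -/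
noncomputable def barycenter {X : Type} (s : Finset X) : X → ℝ :=
  fun x => if x ∈ s then (s.card : ℝ)⁻¹ else 0

lemma support_barycenter {X : Type} (s : Finset X) : support (barycenter s) = s := by
  ext x
  simp only [mem_support, barycenter, Finset.mem_coe]
  split_ifs with h
  · have : s.card ≠ 0 := Finset.card_ne_zero_of_mem h
    simp [h, this]
  · simp [h]

lemma barycenter_pos {X : Type} {s : Finset X} {x : X} (hx : x ∈ s) : 0 < barycenter s x := by
  have : 0 < s.card := Finset.card_pos.2 ⟨x, hx⟩
  simp only [barycenter, hx, if_true]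
  positivity

variable {X : Type} [PartialOrder X] {S : Set X}

lemma mem_geomRealOn_iff [Fintype X] {f : X → ℝ} :
    f ∈ geomRealOn S ↔ (∀ x, 0 ≤ f x) ∧ support f ⊆ S ∧ IsChain (· ≤ ·) (support f) ∧
      ∑ x, f x = 1 := by
  have key (s : Finset X) (hs : support f ⊆ ↑s) : ∑ x ∈ s, f x = ∑ x, f x :=
    Finset.sum_subset s.subset_univ fun x _ hx => by
      by_contra h
      exact hx (hs h)
  constructor
  · rintro ⟨h0, hS, hc, s, hs, h1⟩
    exact ⟨h0, hS, hc, key s hs ▸ h1⟩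
  · rintro ⟨h0, hS, hc, h1⟩
    exact ⟨h0, hS, hc, Finset.univ, by simp, h1⟩

lemma geomRealOn_exists_pos {f : X → ℝ} (hf : f ∈ geomRealOn S) : ∃ x ∈ S, 0 < f x := by
  obtain ⟨h0, hS, -, s, -, h1⟩ := hf
  by_contra! h
  have : ∑ x ∈ s, f x = 0 := Finset.sum_eq_zero fun x _ => by
    by_contra hx
    exact hx (le_antisymm (h x (hS hx)) (h0 x))
  simp [this] at h1

lemma geomRealOn_comparable {f : X → ℝ} (hf : f ∈ geomRealOn S) {x y : X} (hx : 0 < f x)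
    (hy : 0 < f y) : x ≤ y ∨ y ≤ x :=
  hf.2.2.1.total hx.ne' hy.ne'

/-- Two points of the order complex whose supports are nested span a segment in it. -/
lemma geomRealOn_combo [Finite X] {f g : X → ℝ} (hf : f ∈ geomRealOn S) (hg : g ∈ geomRealOn S)
    (hfg : support f ⊆ support g) {a b : ℝ} (ha : 0 ≤ a) (hb : 0 ≤ b) (hab : a + b = 1) :
    a • f + b • g ∈ geomRealOn S := by
  have := Fintype.ofFinite X
  rw [mem_geomRealOn_iff] at *
  have hsupp : support (a • f + b • g) ⊆ support g := by
    intro x hx hgx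
    have hfx : f x = 0 := by
      by_contra h
      exact hfg h hgx
    exact hx (by simp [hfx, hgx])
  refine ⟨fun x => ?_, hsupp.trans hg.2.1, hg.2.2.1.mono hsupp, ?_⟩
  · have := hf.1 x
    have := hg.1 x
    simp only [Pi.add_apply, Pi.smul_apply, smul_eq_mul]
    positivity
  · simp [Finset.sum_add_distrib, ← Finset.mul_sum, hf.2.2.2, hg.2.2.2, hab]

lemma barycenter_mem {s : Finset X} (hs : s.Nonempty) (hsS : ↑s ⊆ S)
    (hc : IsChain (· ≤ ·) (s : Set X)) : barycenter s ∈ geomRealOn S := by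
  refine ⟨fun x => ?_, by rwa [support_barycenter], by rwa [support_barycenter], s,
    (support_barycenter s).subset, ?_⟩
  · unfold barycenter
    split_ifs <;> positivity
  · have : (s.card : ℝ) ≠ 0 := by exact_mod_cast hs.card_ne_zero
    simp [barycenter, Finset.sum_ite_mem, this]

/-- The points of the order complex whose support contains `s`. -/
def openStar (S : Set X) (s : Finset X) : Set (X → ℝ) :=
  {f | f ∈ geomRealOn S ∧ ∀ x ∈ s, 0 < f x}

lemma starConvex_openStar [Finite X] {s : Finset X} (hs : s.Nonempty) (hsS : ↑s ⊆ S)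
    (hc : IsChain (· ≤ ·) (s : Set X)) : StarConvex ℝ (barycenter s) (openStar S s) := by
  intro f hf a b ha hb hab
  refine ⟨geomRealOn_combo (barycenter_mem hs hsS hc) hf.1 ?_ ha hb hab, fun x hx => ?_⟩
  · rw [support_barycenter]
    exact fun x hx => (hf.2 x hx).ne'
  · have h1 := barycenter_pos hx
    have h2 := hf.2 x hx
    simp only [Pi.add_apply, Pi.smul_apply, smul_eq_mul]
    rcases ha.eq_or_lt with rfl | ha
    · have : b = 1 := by linarith
      simpa [this]
    · positivity

lemma barycenter_mem_openStar {s : Finset X} (hs : s.Nonempty) (hsS : ↑s ⊆ S)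
    (hc : IsChain (· ≤ ·) (s : Set X)) : barycenter s ∈ openStar S s :=
  ⟨barycenter_mem hs hsS hc, fun _ hx => barycenter_pos hx⟩

lemma contractibleSpace_openStar [Finite X] {s : Finset X} (hs : s.Nonempty) (hsS : ↑s ⊆ S)
    (hc : IsChain (· ≤ ·) (s : Set X)) : ContractibleSpace (openStar S s) :=
  (starConvex_openStar hs hsS hc).contractibleSpace ⟨_, barycenter_mem_openStar hs hsS hc⟩

lemma isOpen_openStar (s : Finset X) :
    IsOpen {a : geomRealOn S | ∀ x ∈ s, 0 < (a : X → ℝ) x} := by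
  simp only [Set.ofPred_forall]
  refine isOpen_biInter_finset fun x _ => ?_
  exact isOpen_lt continuous_const ((continuous_apply x).comp continuous_subtype_val)

/-- Every point of a star can be joined to every other one inside the star. -/
lemma exists_path_openStar [Finite X] {s : Finset X} (hs : s.Nonempty) (hsS : ↑s ⊆ S)
    (hc : IsChain (· ≤ ·) (s : Set X)) {a b : geomRealOn S}
    (ha : ∀ x ∈ s, 0 < (a : X → ℝ) x) (hb : ∀ x ∈ s, 0 < (b : X → ℝ) x) :
    ∃ γ : Path a b, ∀ t, ∀ x ∈ s, 0 < (γ t : X → ℝ) x := by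
  have := contractibleSpace_openStar hs hsS hc
  let γ : Path (⟨a, a.2, ha⟩ : openStar S s) ⟨b, b.2, hb⟩ := PathConnectedSpace.somePath _ _
  exact ⟨γ.map (f := fun z : openStar S s => (⟨z, z.2.1⟩ : geomRealOn S)) (by fun_prop),
    fun t => (γ t).2.2⟩

lemma homotopic_of_mem_openStar [Finite X] {s : Finset X} (hs : s.Nonempty) (hsS : ↑s ⊆ S)
    (hc : IsChain (· ≤ ·) (s : Set X)) {a b : geomRealOn S} (γ γ' : Path a b)
    (h : ∀ t, ∀ x ∈ s, 0 < (γ t : X → ℝ) x) (h' : ∀ t, ∀ x ∈ s, 0 < (γ' t : X → ℝ) x) :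
    γ.Homotopic γ' := by
  have := contractibleSpace_openStar hs hsS hc
  have ha : ∀ x ∈ s, 0 < (a : X → ℝ) x := by simpa using h 0
  have hb : ∀ x ∈ s, 0 < (b : X → ℝ) x := by simpa using h 1
  let δ : Path (⟨a, a.2, ha⟩ : openStar S s) ⟨b, b.2, hb⟩ :=
    ⟨⟨fun t => ⟨γ t, (γ t).2, h t⟩, by fun_prop⟩, by simp, by simp⟩
  let δ' : Path (⟨a, a.2, ha⟩ : openStar S s) ⟨b, b.2, hb⟩ :=
    ⟨⟨fun t => ⟨γ' t, (γ' t).2, h' t⟩, by fun_prop⟩, by simp, by simp⟩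
  have := (SimplyConnectedSpace.paths_homotopic δ δ').map
    (⟨fun z => ⟨z, z.2.1⟩, by fun_prop⟩ : C(openStar S s, geomRealOn S))
  exact this

lemma locallyPathConnectedSpace_geomRealOn [Finite X] :
    LocallyPathConnectedSpace (geomRealOn S) where
  path_connected_basis a := by
    have := Fintype.ofFinite X
    classical
    rw [Filter.hasBasis_self]
    intro t ht
    have hstar : {b : geomRealOn S | ∀ x ∈ Finset.univ.filter (fun x => 0 < (a : X → ℝ) x),
        0 < (b : X → ℝ) x} ∈ nhds a := (isOpen_openStar _).mem_nhds (by simp)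
    obtain ⟨ε, hε, hball⟩ := Metric.mem_nhds_iff.1 (Filter.inter_mem ht hstar)
    refine ⟨Metric.ball a ε, Metric.ball_mem_nhds _ hε, ?_, fun b hb => (hball hb).1⟩
    rw [Topology.IsInducing.subtypeVal.isPathConnected_iff]
    have himg : Subtype.val '' Metric.ball a ε = Metric.ball (a : X → ℝ) ε ∩ geomRealOn S := by
      ext f
      constructor
      · rintro ⟨b, hb, rfl⟩
        exact ⟨hb, b.2⟩
      · rintro ⟨hf, hf'⟩
        exact ⟨⟨f, hf'⟩, hf, rfl⟩
    rw [himg]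
    have ha : (a : X → ℝ) ∈ Metric.ball (a : X → ℝ) ε := Metric.mem_ball_self hε
    refine StarConvex.isPathConnected (a := (a : X → ℝ)) ?_ ⟨ha, a.2⟩
    intro f hf u v hu hv huv
    refine ⟨(convex_ball _ _) ha hf.1 hu hv huv, geomRealOn_combo a.2 hf.2 ?_ hu hv huv⟩
    intro x hx
    have : (⟨f, hf.2⟩ : geomRealOn S) ∈ Metric.ball a ε := hf.1
    exact ((hball this).2 x (by simpa using (a.2.1 x).lt_of_ne' hx)).ne'

end OrderComplex

section Cocycles

variable {X : Type} [PartialOrder X] {S : Set X}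

/-- `c` is a group-valued 1-cocycle on the poset `S`. -/
def IsPosetCocycle (S : Set X) {Γ : Type} [Group Γ] (c : X → X → Γ) : Prop :=
  ∀ x ∈ S, ∀ y ∈ S, ∀ z ∈ S, x ≤ y → y ≤ z → c x y * c y z = c x z

/-- Every group-valued 1-cocycle on the poset `S` is a coboundary. -/
def CocyclesTrivial (S : Set X) : Prop :=
  ∀ (Γ : Type) [Group Γ] (c : X → X → Γ), IsPosetCocycle S c →
    ∃ f : X → Γ, ∀ x ∈ S, ∀ y ∈ S, x ≤ y → c x y = (f x)⁻¹ * f y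

lemma IsPosetCocycle.self {Γ : Type} [Group Γ] {c : X → X → Γ} (hc : IsPosetCocycle S c) {x : X}
    (hx : x ∈ S) : c x x = 1 := by
  simpa using hc x hx x hx x hx le_rfl le_rfl

open Classical in
/-- The extension of a cocycle to pairs of comparable elements. -/
noncomputable def symCocycle {Γ : Type} [Group Γ] (c : X → X → Γ) (x y : X) : Γ :=
  if x ≤ y then c x y else (c y x)⁻¹

lemma symCocycle_of_le {Γ : Type} [Group Γ] (c : X → X → Γ) {x y : X} (h : x ≤ y) :
    symCocycle c x y = c x y := if_pos h

lemma symCocycle_of_ge {Γ : Type} [Group Γ] {c : X → X → Γ} (hc : IsPosetCocycle S c) {x y : X}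
    (hx : x ∈ S) (h : y ≤ x) : symCocycle c x y = (c y x)⁻¹ := by
  unfold symCocycle
  split_ifs with h'
  · obtain rfl := le_antisymm h h'
    simp [hc.self hx]
  · rfl

lemma symCocycle_mul {Γ : Type} [Group Γ] {c : X → X → Γ} (hc : IsPosetCocycle S c) {x y z : X}
    (hx : x ∈ S) (hy : y ∈ S) (hz : z ∈ S) (hxy : x ≤ y ∨ y ≤ x) (hyz : y ≤ z ∨ z ≤ y)
    (hxz : x ≤ z ∨ z ≤ x) :
    symCocycle c x y * symCocycle c y z = symCocycle c x z := by
  have key (u v w : X) (hu : u ∈ S) (hv : v ∈ S) (hw : w ∈ S) (h : u ≤ v) (h' : v ≤ w) :=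
    hc u hu v hv w hw h h'
  rcases hxy with h1 | h1 <;> rcases hyz with h2 | h2 <;> rcases hxz with h3 | h3 <;>
    first
      | rw [symCocycle_of_le c h1] | rw [symCocycle_of_ge hc hx h1]
  all_goals
    first
      | rw [symCocycle_of_le c h2] | rw [symCocycle_of_ge hc hy h2]
  all_goals
    first
      | rw [symCocycle_of_le c h3] | rw [symCocycle_of_ge hc hx h3]
  · exact key _ _ _ hx hy hz h1 h2
  · obtain rfl := le_antisymm h1 (h2.trans h3)
    obtain rfl := le_antisymm h2 h3
    simp [hc.self hx]
  · rw [← key _ _ _ hx hz hy h3 h2]; group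
  · rw [← key _ _ _ hz hx hy h3 h1]; group
  · rw [← key _ _ _ hy hx hz h1 h3]; group
  · rw [← key _ _ _ hy hz hx h2 h3]; group
  · obtain rfl := le_antisymm (h2.trans h1) h3
    obtain rfl := le_antisymm h1 h2
    simp [hc.self hx]
  · rw [← key _ _ _ hz hy hx h2 h1]; group

/-- The principal bundle over the order complex defined by a cocycle. -/
noncomputable def cocycleBundle {Γ : Type} [Group Γ] [TopologicalSpace Γ] [DiscreteTopology Γ]
    (c : X → X → Γ) (hc : IsPosetCocycle S c) : FiberBundleCore S (geomRealOn S) Γ where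
  baseSet x := {a | ∀ y ∈ ({x.1} : Finset X), 0 < (a : X → ℝ) y}
  isOpen_baseSet x := isOpen_openStar _
  indexAt a := ⟨(geomRealOn_exists_pos a.2).choose, (geomRealOn_exists_pos a.2).choose_spec.1⟩
  mem_baseSet_at a := by simpa using (geomRealOn_exists_pos a.2).choose_spec.2
  coordChange x y _ v := (symCocycle c x y)⁻¹ * v
  coordChange_self x _ _ v := by simp [symCocycle_of_le, hc.self x.2]
  continuousOn_coordChange _ _ := Continuous.continuousOn (by
    have : Continuous fun v : Γ => v := continuous_id
    exact (continuous_of_discreteTopology (f := fun v : Γ => (symCocycle c _ _)⁻¹ * v)).comp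
      continuous_snd)
  coordChange_comp x y z a ha v := by
    simp only [Finset.mem_singleton, forall_eq] at ha
    obtain ⟨⟨hx, hy⟩, hz⟩ := ha
    rw [← symCocycle_mul hc x.2 y.2 z.2 (geomRealOn_comparable a.2 hx hy)
      (geomRealOn_comparable a.2 hy hz) (geomRealOn_comparable a.2 hx hz)]
    group

lemma isPathConnected_star [Finite X] {x : X} (hx : x ∈ S) :
    IsPathConnected {a : geomRealOn S | ∀ y ∈ ({x} : Finset X), 0 < (a : X → ℝ) y} := by
  have hb := barycenter_mem_openStar (S := S) (s := {x}) (by simp) (by simpa) (by simp)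
  refine ⟨⟨_, hb.1⟩, hb.2, fun {b} hb' => ?_⟩
  obtain ⟨γ, hγ⟩ := exists_path_openStar (S := S) (s := {x}) (by simp) (by simpa) (by simp)
    (a := ⟨_, hb.1⟩) (b := b) hb.2 hb'
  exact ⟨γ, hγ⟩

theorem cocyclesTrivial_of_simplyConnected [Finite X] (h : SimplyConnectedSpace (geomRealOn S)) :
    CocyclesTrivial S := by
  intro Γ _ c hc
  let _ : TopologicalSpace Γ := ⊥
  have : DiscreteTopology Γ := ⟨rfl⟩
  have := locallyPathConnectedSpace_geomRealOn (S := S)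
  let Z := cocycleBundle c hc
  have cov : IsCoveringMap (Bundle.TotalSpace.proj (F := Γ) (E := Z.Fiber)) :=
    FiberBundle.isCoveringMap
  obtain ⟨a₀⟩ : Nonempty (geomRealOn S) := inferInstance
  obtain ⟨σ, ⟨-, hσ⟩, -⟩ := cov.existsUnique_continuousMap_lifts (ContinuousMap.id _) a₀
    ⟨a₀, (1 : Γ)⟩ rfl
  have hσ' (a) : (σ a).1 = a := congrFun hσ a
  let g (x : S) (a : geomRealOn S) : Γ := (Z.localTriv x (σ a)).2
  have hg (x : S) : ContinuousOn (g x) (Z.baseSet x) := by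
    refine continuous_snd.comp_continuousOn ?_
    refine (Z.localTriv x).continuousOn.comp σ.continuous.continuousOn ?_
    intro a ha
    rw [Z.mem_localTriv_source]
    change (σ a).1 ∈ Z.baseSet x
    rwa [hσ']
  have hconst (x : S) {a b} (ha : a ∈ Z.baseSet x) (hb : b ∈ Z.baseSet x) : g x a = g x b :=
    (isPathConnected_star x.2).isConnected.isPreconnected.constant (hg x) ha hb
  have hv (x : S) : ∃ a, a ∈ Z.baseSet x := (isPathConnected_star x.2).nonempty
  choose v hv using hv
  classical
  refine ⟨fun x => if hx : x ∈ S then (g ⟨x, hx⟩ (v ⟨x, hx⟩))⁻¹ else 1, fun x hx y hy hxy => ?_⟩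
  have hm := barycenter_mem_openStar (S := S) (s := {x, y}) (by simp)
    (by simp [Set.insert_subset_iff, hx, hy]) (by simpa using IsChain.pair hxy)
  set m : geomRealOn S := ⟨_, hm.1⟩
  have hmx : m ∈ Z.baseSet ⟨x, hx⟩ := by
    intro z hz
    exact hm.2 z (by simp_all)
  have hmy : m ∈ Z.baseSet ⟨y, hy⟩ := by
    intro z hz
    exact hm.2 z (by simp_all)
  simp only [hx, hy, dif_pos, inv_inv]
  rw [hconst ⟨x, hx⟩ (hv _) hmx, hconst ⟨y, hy⟩ (hv _) hmy]
  have hcomp := Z.coordChange_comp (Z.indexAt (σ m).1) ⟨x, hx⟩ ⟨y, hy⟩ (σ m).1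
    ⟨⟨Z.mem_baseSet_at _, by rwa [hσ']⟩, by rwa [hσ']⟩ (σ m).2
  have : (symCocycle c x y)⁻¹ * g ⟨x, hx⟩ m = g ⟨y, hy⟩ m := hcomp
  rw [← this, symCocycle_of_le c hxy]
  group

end Cocycles

section SimplyConnected

open CategoryTheory

variable {X : Type} [PartialOrder X] {S : Set X}

lemma comp_fromPath_eq_of_locally {Y : Type} [TopologicalSpace Y] {B : FundamentalGroupoid Y}
    (T : ∀ a : Y, B ⟶ FundamentalGroupoid.mk a)
    (hT : ∀ a : Y, ∃ U ∈ nhds a, ∀ (b c : Y) (γ : Path b c), (∀ t, γ t ∈ U) →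
      T b ≫ FundamentalGroupoid.fromPath (.mk γ) = T c)
    {a b : Y} (γ : Path a b) : T a ≫ FundamentalGroupoid.fromPath (.mk γ) = T b := by
  have key (s t : unitInterval) :
      T (γ s) ≫ FundamentalGroupoid.fromPath (.mk (γ.subpath s t)) = T (γ t) := by
    have hsymm : Std.Symm (fun s t => T (γ s) ≫
        FundamentalGroupoid.fromPath (.mk (γ.subpath s t)) = T (γ t)) := by
      refine ⟨fun s t h => ?_⟩
      have : FundamentalGroupoid.fromPath (.mk (γ.subpath t s)) =
          inv (FundamentalGroupoid.fromPath (.mk (γ.subpath s t))) := by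
        rw [← Path.symm_subpath, ← Groupoid.inv_eq_inv]
        rfl
      rw [this, ← h]
      simp
    refine PreconnectedSpace.induction₂ (fun s t => T (γ s) ≫
      FundamentalGroupoid.fromPath (.mk (γ.subpath s t)) = T (γ t)) ?_ ?_ s t
    · intro s
      obtain ⟨U, hU, h⟩ := hT (γ s)
      have hU' : γ ⁻¹' U ∈ nhds s := γ.continuous.continuousAt hU
      have := ((tendsto_const_nhds (x := s) (f := nhds s)).uIcc
        Filter.tendsto_id).eventually (Filter.eventually_smallSets_subset.2 hU')
      filter_upwards [this] with t ht
      refine h _ _ _ fun u => ?_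
      have : γ.subpath s t u ∈ Set.range (γ.subpath s t) := ⟨u, rfl⟩
      rw [Path.range_subpath] at this
      obtain ⟨w, hw, hw'⟩ := this
      rw [← hw']
      exact ht hw
    · refine ⟨fun s t u h1 h2 => ?_⟩
      have : FundamentalGroupoid.fromPath (.mk (γ.subpath s t)) ≫
          FundamentalGroupoid.fromPath (.mk (γ.subpath t u)) =
          FundamentalGroupoid.fromPath (.mk (γ.subpath s u)) :=
        Quotient.sound ⟨Path.Homotopy.subpathTransSubpath γ s t u⟩
      rw [← this, ← Category.assoc, h1, h2]
  obtain ⟨γ, h0, h1⟩ := γ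
  subst h0 h1
  have := key 0 1
  rwa [Path.subpath_zero_one] at this

lemma pathConnectedSpace_geomRealOn [Finite X] (hne : S.Nonempty)
    (hconn : ∀ x y : S, Relation.EqvGen (fun a b : S => a ≤ b) x y) :
    PathConnectedSpace (geomRealOn S) := by
  have hpt (x : S) : ∃ a : geomRealOn S, 0 < (a : X → ℝ) x := by
    have hb := barycenter_mem_openStar (S := S) (s := {x.1}) (by simp) (by simp) (by simp)
    exact ⟨⟨_, hb.1⟩, by simpa using hb.2⟩
  have hstar (x : S) (a b : geomRealOn S) (ha : 0 < (a : X → ℝ) x) (hb : 0 < (b : X → ℝ) x) :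
      Joined a b := by
    obtain ⟨γ, -⟩ := exists_path_openStar (S := S) (s := {x.1}) (by simp) (by simp) (by simp)
      (a := a) (b := b) (by simpa) (by simpa)
    exact ⟨γ⟩
  have key (x y : S) (h : Relation.EqvGen (fun a b : S => a ≤ b) x y) :
      ∀ a b : geomRealOn S, 0 < (a : X → ℝ) x → 0 < (b : X → ℝ) y → Joined a b := by
    induction h with
    | rel x y h =>
      intro a b ha hb
      classical
      have hm := barycenter_mem_openStar (S := S) (s := {x.1, y.1}) (by simp)
        (by simp [Set.insert_subset_iff]) (by simpa using IsChain.pair (show x.1 ≤ y.1 from h))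
      exact (hstar x a ⟨_, hm.1⟩ ha (hm.2 _ (by simp))).trans
        (hstar y ⟨_, hm.1⟩ b (hm.2 _ (by simp)) hb)
    | refl x => exact hstar x
    | symm x y _ ih => exact fun a b ha hb => (ih b a hb ha).symm
    | trans x y z _ _ ih1 ih2 =>
      intro a b ha hb
      obtain ⟨m, hm⟩ := hpt y
      exact (ih1 a m ha hm).trans (ih2 m b hm hb)
  obtain ⟨x, hx⟩ := hne
  refine ⟨⟨(hpt ⟨x, hx⟩).choose⟩, fun a b => ?_⟩
  obtain ⟨x, hx, hxa⟩ := geomRealOn_exists_pos a.2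
  obtain ⟨y, hy, hyb⟩ := geomRealOn_exists_pos b.2
  exact key ⟨x, hx⟩ ⟨y, hy⟩ (hconn _ _) a b hxa hyb

theorem simplyConnected_of_cocyclesTrivial [Finite X] (hne : S.Nonempty)
    (hconn : ∀ x y : S, Relation.EqvGen (fun a b : S => a ≤ b) x y) (h : CocyclesTrivial S) :
    SimplyConnectedSpace (geomRealOn S) := by
  classical
  have := pathConnectedSpace_geomRealOn hne hconn
  rw [simply_connected_iff_loops_nullhomotopic]
  refine ⟨this, ?_⟩
  have hvert (x : S) : ∃ a : geomRealOn S, 0 < (a : X → ℝ) x := by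
    have hb := barycenter_mem_openStar (S := S) (s := {x.1}) (by simp) (by simp) (by simp)
    exact ⟨⟨_, hb.1⟩, by simpa using hb.2⟩
  choose v hv using hvert
  have hP (x : S) (a : geomRealOn S) (ha : 0 < (a : X → ℝ) x) :
      ∃ γ : Path (v x) a, ∀ t, ∀ y ∈ ({x.1} : Finset X), 0 < (γ t : X → ℝ) y :=
    exists_path_openStar (by simp) (by simp) (by simp) (by simpa using hv x) (by simpa)
  choose P hP using hP
  let q (x : S) (a : geomRealOn S) (ha : 0 < (a : X → ℝ) x) :
    FundamentalGroupoid.mk (v x) ⟶ FundamentalGroupoid.mk a :=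
      FundamentalGroupoid.fromPath (.mk (P x a ha))
  have hq (x : S) (a b : geomRealOn S) (γ : Path a b) (hγ : ∀ t, 0 < (γ t : X → ℝ) x)
      (ha : 0 < (a : X → ℝ) x) (hb : 0 < (b : X → ℝ) x) :
      q x a ha ≫ FundamentalGroupoid.fromPath (.mk γ) = q x b hb := by
    refine Quotient.sound (homotopic_of_mem_openStar (s := {x.1}) (by simp) (by simp) (by simp)
      ((P x a ha).trans γ) (P x b hb) (fun t => ?_) (hP x b hb))
    rw [Path.trans_apply]
    split_ifs
    · exact hP x a ha _
    · simpa using hγ _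
  have hqq (x y : S) (hxy : x ≤ y) (a b : geomRealOn S) (hax : 0 < (a : X → ℝ) x)
      (hay : 0 < (a : X → ℝ) y) (hbx : 0 < (b : X → ℝ) x) (hby : 0 < (b : X → ℝ) y) :
      q y a hay ≫ inv (q x a hax) = q y b hby ≫ inv (q x b hbx) := by
    obtain ⟨γ, hγ⟩ := exists_path_openStar (S := S) (s := {x.1, y.1}) (by simp)
      (by simp [Set.insert_subset_iff]) (by simpa using IsChain.pair (show x.1 ≤ y.1 from hxy))
      (a := a) (b := b) (by simp [hax, hay]) (by simp [hbx, hby])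
    rw [← hq x a b γ (fun t => hγ t _ (by simp)) hax hbx,
      ← hq y a b γ (fun t => hγ t _ (by simp)) hay hby]
    simp
  obtain ⟨x₀⟩ := hne.to_subtype
  let t (x : S) : FundamentalGroupoid.mk (v x₀) ⟶ FundamentalGroupoid.mk (v x) :=
    FundamentalGroupoid.fromPath (.mk (PathConnectedSpace.somePath _ _))
  have hm (x y : S) (hxy : x ≤ y) :
      ∃ a : geomRealOn S, 0 < (a : X → ℝ) x ∧ 0 < (a : X → ℝ) y := by
    have hm := barycenter_mem_openStar (S := S) (s := {x.1, y.1}) (by simp)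
      (by simp [Set.insert_subset_iff]) (by simpa using IsChain.pair (show x.1 ≤ y.1 from hxy))
    exact ⟨⟨_, hm.1⟩, hm.2 _ (by simp), hm.2 _ (by simp)⟩
  choose m hmx hmy using hm
  let c (x y : X) : End (FundamentalGroupoid.mk (v x₀)) :=
    if h : ∃ (hx : x ∈ S) (hy : y ∈ S), x ≤ y then
      t ⟨y, h.2.1⟩ ≫ q ⟨y, h.2.1⟩ (m ⟨x, h.1⟩ ⟨y, h.2.1⟩ h.2.2) (hmy _ _ _) ≫
        inv (q ⟨x, h.1⟩ (m ⟨x, h.1⟩ ⟨y, h.2.1⟩ h.2.2) (hmx _ _ _)) ≫ inv (t ⟨x, h.1⟩)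
    else 1
  have hc_apply (x y : S) (hxy : x ≤ y) (a : geomRealOn S) (hax : 0 < (a : X → ℝ) x)
      (hay : 0 < (a : X → ℝ) y) :
      c x y = (t y ≫ q y a hay ≫ inv (q x a hax) ≫ inv (t x) :) := by
    have : ∃ (hx : x.1 ∈ S) (hy : y.1 ∈ S), x.1 ≤ y.1 := ⟨x.2, y.2, hxy⟩
    simp only [c, dif_pos this]
    congr 1
    simp only [← Category.assoc]
    rw [hqq x y hxy _ a _ _ hax hay]
  have hcc : IsPosetCocycle S c := by
    intro x hx y hy z hz hxy hyz
    have hm := barycenter_mem_openStar (S := S) (s := {x, y, z}) (by simp)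
      (by simp [Set.insert_subset_iff, hx, hy, hz]) (by
        simp only [Finset.coe_insert, Finset.coe_singleton]
        refine (IsChain.pair hyz).insert ?_
        rintro w (rfl | rfl) -
        exacts [.inl hxy, .inl (hxy.trans hyz)])
    have hax := hm.2 x (by simp)
    have hay := hm.2 y (by simp)
    have haz := hm.2 z (by simp)
    rw [hc_apply ⟨x, hx⟩ ⟨y, hy⟩ hxy ⟨_, hm.1⟩ hax hay,
      hc_apply ⟨y, hy⟩ ⟨z, hz⟩ hyz ⟨_, hm.1⟩ hay haz,
      hc_apply ⟨x, hx⟩ ⟨z, hz⟩ (hxy.trans hyz) ⟨_, hm.1⟩ hax haz, CategoryTheory.End.mul_def]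
    simp
  obtain ⟨f, hf⟩ := h _ c hcc
  let F (x : X) : FundamentalGroupoid.mk (v x₀) ⟶ FundamentalGroupoid.mk (v x₀) := f x
  let T (x : S) : FundamentalGroupoid.mk (v x₀) ⟶ FundamentalGroupoid.mk (v x) :=
    inv (F x) ≫ t x
  have hTle (x y : S) (hxy : x ≤ y) (a : geomRealOn S) (hax : 0 < (a : X → ℝ) x)
      (hay : 0 < (a : X → ℝ) y) : T x ≫ q x a hax = T y ≫ q y a hay := by
    have h1 := hf x x.2 y y.2 hxy
    rw [hc_apply x y hxy a hax hay] at h1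
    have h2 : t y ≫ q y a hay ≫ inv (q x a hax) ≫ inv (t x) = F y ≫ inv (F x) := by
      rw [h1, ← Groupoid.inv_eq_inv]
      rfl
    simp only [T, Category.assoc]
    rw [IsIso.eq_inv_comp, ← Category.assoc, ← h2]
    simp
  have hTT (x y : S) (a : geomRealOn S) (hax : 0 < (a : X → ℝ) x)
      (hay : 0 < (a : X → ℝ) y) : T x ≫ q x a hax = T y ≫ q y a hay := by
    rcases geomRealOn_comparable a.2 hax hay with hxy | hxy
    · exact hTle x y hxy a hax hay
    · exact (hTle y x hxy a hay hax).symm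
  have hsupp (a : geomRealOn S) : ∃ x : S, 0 < (a : X → ℝ) x := by
    obtain ⟨x, hx, hxa⟩ := geomRealOn_exists_pos a.2
    exact ⟨⟨x, hx⟩, hxa⟩
  choose s hs using hsupp
  intro a γ
  have := comp_fromPath_eq_of_locally (fun a => T (s a) ≫ q (s a) a (hs a)) (fun a => by
    refine ⟨_, (isOpen_openStar {(s a).1}).mem_nhds (by simpa using hs a), fun b c γ hγ => ?_⟩
    have hb : 0 < (b : X → ℝ) (s a) := by simpa using hγ 0
    have hc : 0 < (c : X → ℝ) (s a) := by simpa using hγ 1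
    rw [hTT (s b) (s a) b (hs b) hb, hTT (s c) (s a) c (hs c) hc, Category.assoc,
      hq (s a) b c γ (fun t => hγ t _ (by simp))]) γ
  have h1 : FundamentalGroupoid.fromPath (.mk γ) = 𝟙 (FundamentalGroupoid.mk a) :=
    (cancel_epi (T (s a) ≫ q (s a) a (hs a))).1 (this.trans (Category.comp_id _).symm)
  exact Quotient.exact h1

end SimplyConnected

section CoprimeAction

open Subgroup

variable {p : ℕ}

lemma IsElementaryAbelian.pow_eq_one {H : Type*} [Group H] {V : Subgroup H}
    (hV : IsElementaryAbelian p V) {v : H} (hv : v ∈ V) : v ^ p = 1 := by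
  simpa using congrArg Subtype.val (hV.2 ⟨v, hv⟩)

lemma IsElementaryAbelian.mul_comm {H : Type*} [Group H] {V : Subgroup H}
    (hV : IsElementaryAbelian p V) {u v : H} (hu : u ∈ V) (hv : v ∈ V) : u * v = v * u :=
  congrArg Subtype.val (hV.1 ⟨u, hu⟩ ⟨v, hv⟩)

lemma IsElementaryAbelian.isPGroup {H : Type*} [Group H] (hV : IsElementaryAbelian p H) :
    IsPGroup p H :=
  fun v => ⟨1, by rw [pow_one, hV.2]⟩

lemma IsElementaryAbelian.mono {H : Type*} [Group H] {U V : Subgroup H}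
    (hV : IsElementaryAbelian p V) (h : U ≤ V) : IsElementaryAbelian p U :=
  ⟨fun a b => Subtype.ext (hV.mul_comm (h a.2) (h b.2)),
    fun a => Subtype.ext (by simpa using hV.pow_eq_one (h a.2))⟩

variable [hp : Fact p.Prime]

lemma exists_fixed_abelianization_eq {M : Type*} [Group M] [Finite M] (hM : ¬ p ∣ Nat.card M)
    (σ : MulAut M) (hσ : σ ^ p = 1) (m : M) :
    ∃ y : M, σ y = y ∧
      Abelianization.of y = ∏ k ∈ Finset.range p, Abelianization.of ((σ ^ k) m) := by
  classical
  set z := ∏ k ∈ Finset.range p, Abelianization.of ((σ ^ k) m) with hz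
  have hσz : Abelianization.map σ.toMonoidHom z = z := by
    have h1 : Abelianization.map σ.toMonoidHom z =
        ∏ k ∈ Finset.range p, Abelianization.of ((σ ^ (k + 1)) m) := by
      rw [hz, map_prod]
      refine Finset.prod_congr rfl fun k _ => ?_
      rw [pow_succ']
      rfl
    have h2 := Finset.prod_range_succ (fun k => Abelianization.of ((σ ^ k) m)) p
    rw [Finset.prod_range_succ', hσ, pow_zero, mul_left_inj] at h2
    rw [h1, h2]
  let α := {y : M // Abelianization.of y = z}
  have hmap (y : M) : Abelianization.of (σ y) = Abelianization.map σ.toMonoidHom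
    (Abelianization.of y) := rfl
  have hinj : Function.Injective (Abelianization.map σ.toMonoidHom) := by
    have : Function.LeftInverse (Abelianization.map σ.symm.toMonoidHom)
        (Abelianization.map σ.toMonoidHom) := by
      intro x
      obtain ⟨x, rfl⟩ := QuotientGroup.mk_surjective x
      change Abelianization.of (σ.symm (σ x)) = _
      rw [MulEquiv.symm_apply_apply]
      rfl
    exact this.injective
  let τ : Equiv.Perm α := σ.toEquiv.subtypeEquiv fun y => by
    change _ ↔ Abelianization.of (σ y) = z
    rw [hmap]
    nth_rw 2 [← hσz]
    exact hinj.eq_iff.symm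
  have hτ (k : ℕ) (y : α) : ((τ ^ k) y : M) = (σ ^ k) y := by
    induction k with
    | zero => rfl
    | succ k ih =>
      rw [pow_succ', pow_succ', Equiv.Perm.mul_apply, MulAut.mul_apply, ← ih]
      rfl
  have hα : ¬ p ∣ Nat.card α := by
    obtain ⟨y₀, hy₀⟩ := QuotientGroup.mk_surjective z
    have e : α ≃ (Abelianization.of : M →* _).ker :=
      (Equiv.mulLeft y₀⁻¹).subtypeEquiv fun y => by
        change _ ↔ y₀⁻¹ * y ∈ (Abelianization.of : M →* _).ker
        rw [MonoidHom.mem_ker, map_mul, map_inv, inv_mul_eq_one, ← hy₀]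
        exact eq_comm
    rw [Nat.card_congr e]
    exact fun h => hM (h.trans (Subgroup.card_subgroup_dvd_card _))
  have := Fintype.ofFinite α
  rw [Nat.card_eq_fintype_card] at hα
  obtain ⟨y, hy⟩ := Equiv.Perm.exists_fixed_point_of_prime (n := 1) hα (σ := τ) (by
    ext y
    rw [hτ, pow_one, hσ]
    rfl)
  exact ⟨y, congrArg Subtype.val hy, y.2⟩

lemma prod_zmod_identity {B : Type*} [CommGroup B] (F : ZMod p → ZMod p → B) :
    (∏ i, ∏ j, F (i * j) j) * ∏ k, F k 0 = F 0 0 ^ p * ∏ j, ∏ k, F k j := by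
  rw [Finset.prod_comm, ← Finset.mul_prod_erase _ _ (Finset.mem_univ (0 : ZMod p)),
    ← Finset.mul_prod_erase Finset.univ (fun j => ∏ k, F k j) (Finset.mem_univ (0 : ZMod p))]
  have : ∏ j ∈ Finset.univ.erase (0 : ZMod p), ∏ i, F (i * j) j =
      ∏ j ∈ Finset.univ.erase (0 : ZMod p), ∏ k, F k j := by
    refine Finset.prod_congr rfl fun j hj => ?_
    exact Fintype.prod_equiv (Equiv.mulRight₀ j (Finset.ne_of_mem_erase hj)) _ _ fun _ => rfl
  rw [this]
  simp only [mul_zero, Finset.prod_const, Finset.card_univ, ZMod.card]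
  exact (mul_assoc _ _ _).trans (congrArg _ (mul_comm _ _))

lemma prod_zmod_val {B : Type*} [CommMonoid B] (f : ℕ → B) :
    ∏ k : ZMod p, f k.val = ∏ k ∈ Finset.range p, f k := by
  obtain ⟨n, rfl⟩ := Nat.exists_eq_succ_of_ne_zero hp.out.ne_zero
  exact (Finset.prod_range f).symm

/-- The elements fixed by some nontrivial element of a noncyclic abelian group of automorphisms
of exponent `p` generate the group modulo its commutator subgroup. -/
lemma exists_mem_closure_fixed_abelianization_eq {M : Type*} [Group M] [Finite M]
    (hM : ¬ p ∣ Nat.card M)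
    (α β : MulAut M) (hα : α ^ p = 1) (hβ : β ^ p = 1) (hαβ : Commute α β) (m : M) :
    ∃ y ∈ closure {x | α x = x ∨ ∃ i : ℕ, (α ^ i * β) x = x},
      Abelianization.of y = Abelianization.of m := by
  set K := closure {x | α x = x ∨ ∃ i : ℕ, (α ^ i * β) x = x}
  let P : Subgroup (Abelianization M) := K.map Abelianization.of
  let F (k j : ZMod p) : Abelianization M := Abelianization.of ((α ^ k.val) ((β ^ j.val) m))
  have hid := prod_zmod_identity F
  have h1 (i : ZMod p) : ∏ j, F (i * j) j ∈ P := by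
    have : ∏ j, F (i * j) j =
        ∏ k ∈ Finset.range p, Abelianization.of (((α ^ i.val * β) ^ k) m) := by
      rw [← prod_zmod_val]
      refine Finset.prod_congr rfl fun j _ => ?_
      rw [(hαβ.pow_left _).mul_pow, ← pow_mul, pow_eq_pow_mod (i.val * j.val) hα, ← ZMod.val_mul]
      rfl
    rw [this]
    obtain ⟨y, hy, hy'⟩ := exists_fixed_abelianization_eq hM (α ^ i.val * β) (by
      rw [(hαβ.pow_left _).mul_pow, ← pow_mul, mul_comm, pow_mul, hα, hβ]; simp) m
    exact ⟨y, subset_closure (.inr ⟨_, hy⟩), hy'⟩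
  have h2 (j : ZMod p) : ∏ k, F k j ∈ P := by
    have : ∏ k, F k j = ∏ k ∈ Finset.range p, Abelianization.of ((α ^ k) ((β ^ j.val) m)) := by
      rw [← prod_zmod_val]
    rw [this]
    obtain ⟨y, hy, hy'⟩ := exists_fixed_abelianization_eq hM α hα ((β ^ j.val) m)
    exact ⟨y, subset_closure (.inl hy), hy'⟩
  have h3 : Abelianization.of m ^ p ∈ P := by
    have h4 : Abelianization.of m = F 0 0 := by simp [F]
    rw [h4, ← P.mul_mem_cancel_right (P.prod_mem fun j _ => h2 j), ← hid]
    exact P.mul_mem (P.prod_mem fun j _ => h1 j) (h2 0)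
  have hco : (orderOf (Abelianization.of m)).Coprime p := by
    rw [Nat.coprime_comm, hp.out.coprime_iff_not_dvd]
    exact fun h => hM ((h.trans (orderOf_map_dvd _ m)).trans (orderOf_dvd_natCard m))
  obtain ⟨k, hk⟩ := exists_pow_eq_self_of_coprime hco.symm
  rw [← hk]
  exact P.pow_mem h3 k

lemma exists_invariant_sylow {H : Type*} [Group H] [Finite H] {V M : Subgroup H}
    (hV : IsPGroup p V) (hVM : V ≤ normalizer (M : Set H)) (hM : ¬ p ∣ Nat.card M)
    (q : ℕ) [Fact q.Prime] :
    ∃ Q ≤ M, Nat.card Q = q ^ (Nat.card M).factorization q ∧ V ≤ normalizer (Q : Set H) := by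
  let φ : V →* MulAut M := M.normalizerMonoidHom.comp (inclusion hVM)
  let _ := MulDistribMulAction.compHom M φ
  obtain ⟨Q, hQ⟩ := hV.nonempty_fixed_point_of_prime_not_dvd_card (Sylow q M) (fun h => by
    obtain ⟨Q⟩ := (inferInstance : Nonempty (Sylow q M))
    exact hM ((h.trans (Q.card_dvd_index)).trans (Q.index_dvd_card)))
  refine ⟨Q.1.map M.subtype, map_subtype_le _, ?_, fun v hv => ?_⟩
  · rw [← Q.card_eq_multiplicity]
    exact (Nat.card_congr (Q.1.equivMapOfInjective M.subtype M.subtype_injective).toEquiv).symm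
  · have h (v : H) (hv : v ∈ V) (x : H) (hx : x ∈ Q.1.map M.subtype) :
        v * x * v⁻¹ ∈ Q.1.map M.subtype := by
      obtain ⟨x, hx, rfl⟩ := hx
      have h1 : (⟨v, hv⟩ : V) • x ∈ (⟨v, hv⟩ : V) • Q := Set.smul_mem_smul_set hx
      rw [hQ] at h1
      exact ⟨_, h1, rfl⟩
    rw [mem_normalizer_iff]
    refine fun x => ⟨h v hv x, fun hx => ?_⟩
    have := h v⁻¹ (inv_mem hv) _ hx
    simpa [mul_assoc] using this

/-- Coprime generation by centralizers of nontrivial elements of a noncyclic elementary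
abelian group. -/
lemma le_closure_commuting {H : Type*} [Group H] [Finite H] {V : Subgroup H}
    (hV : IsElementaryAbelian p V) {u v : H} (hu : u ∈ V) (hv : v ∈ V) (hu1 : u ≠ 1)
    (huv : v ∉ zpowers u) (M : Subgroup H) (hVM : V ≤ normalizer (M : Set H))
    (hM : ¬ p ∣ Nat.card M) :
    M ≤ closure {x | x ∈ M ∧ ∃ w ∈ V, w ≠ 1 ∧ w * x = x * w} := by
  induction hn : Nat.card M using Nat.strong_induction_on generalizing M with
  | _ n ih =>
  subst hn
  set C := closure {x | x ∈ M ∧ ∃ w ∈ V, w ≠ 1 ∧ w * x = x * w} with hC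
  have hCM : C ≤ M := (closure_le _).2 fun x hx => hx.1
  have hlt (Q : Subgroup H) (hQM : Q < M) (hQ : V ≤ normalizer (Q : Set H)) : Q ≤ C := by
    have hcard : Nat.card Q < Nat.card M :=
      lt_of_le_of_ne (Nat.le_of_dvd Nat.card_pos (card_dvd_of_le hQM.le))
        fun h => hQM.ne (eq_of_le_of_card_ge hQM.le h.ge)
    refine (ih _ hcard Q hQ (fun h => hM (h.trans (card_dvd_of_le hQM.le))) rfl).trans
      (closure_mono fun x hx => ⟨hQM.le hx.1, hx.2⟩)
  by_cases hq : ∃ q, q.Prime ∧ IsPGroup q M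
  · obtain ⟨q, hqp, hq⟩ := hq
    have : Fact q.Prime := ⟨hqp⟩
    by_cases hbot : M = ⊥
    · rw [hbot]; exact bot_le
    have : Nontrivial M := (nontrivial_iff_ne_bot M).2 hbot
    have hnil : Group.IsNilpotent M := hq.isNilpotent
    have hsol : Group.IsSolvable M := inferInstance
    have hcomm : commutator M < ⊤ := Group.IsSolvable.commutator_lt_top_of_nontrivial M
    have hD : (commutator M).map M.subtype ≤ C := by
      refine hlt _ ?_ ?_
      · refine lt_of_le_of_ne (map_subtype_le _) fun h => hcomm.ne ?_
        apply map_injective M.subtype_injective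
        rw [h, ← MonoidHom.range_eq_map, range_subtype]
      · rw [map_subtype_commutator]
        refine fun w hw => ?_
        rw [mem_normalizer_iff_map_conj_eq, map_commutator,
          mem_normalizer_iff_map_conj_eq.1 (hVM hw)]
    let φ : V →* MulAut M := M.normalizerMonoidHom.comp (inclusion hVM)
    intro m hm
    have hcm : Commute (⟨u, hu⟩ : V) ⟨v, hv⟩ := hV.1 _ _
    obtain ⟨y, hy, hym⟩ := exists_mem_closure_fixed_abelianization_eq hM (φ ⟨u, hu⟩) (φ ⟨v, hv⟩)
      (by rw [← map_pow, hV.2, map_one]) (by rw [← map_pow, hV.2, map_one])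
      (hcm.map φ) ⟨m, hm⟩
    have hyC : (y : H) ∈ C := by
      have hle : closure {x | φ ⟨u, hu⟩ x = x ∨ ∃ i : ℕ, (φ ⟨u, hu⟩ ^ i * φ ⟨v, hv⟩) x = x} ≤
          C.comap M.subtype := by
        refine (closure_le _).2 fun x hx => subset_closure ⟨x.2, ?_⟩
        rcases hx with hx | ⟨i, hx⟩
        · exact ⟨u, hu, hu1, mul_inv_eq_iff_eq_mul.1 (congrArg Subtype.val hx)⟩
        · refine ⟨u ^ i * v, V.mul_mem (V.pow_mem hu i) hv, fun h => huv ?_, ?_⟩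
          · rw [eq_inv_of_mul_eq_one_right h]
            exact inv_mem (pow_mem (mem_zpowers u) i)
          · rw [← map_pow, ← map_mul] at hx
            exact mul_inv_eq_iff_eq_mul.1 (congrArg Subtype.val hx)
      exact hle hy
    have h1 : y⁻¹ * ⟨m, hm⟩ ∈ commutator M := by
      rw [← QuotientGroup.eq_one_iff, QuotientGroup.mk_mul, QuotientGroup.mk_inv, inv_mul_eq_one]
      exact hym
    have h2 : (y : H)⁻¹ * m ∈ C := hD ⟨_, h1, rfl⟩
    simpa using C.mul_mem hyC h2
  · suffices h : Nat.card M ∣ Nat.card C from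
      (eq_of_le_of_card_ge hCM (Nat.le_of_dvd Nat.card_pos h)).ge
    rw [← Nat.factorization_prime_le_iff_dvd Nat.card_pos.ne' Nat.card_pos.ne']
    intro q hqp
    have : Fact q.Prime := ⟨hqp⟩
    obtain ⟨Q, hQM, hQ, hVQ⟩ := exists_invariant_sylow hV.isPGroup hVM hM q
    have hQC : Q ≤ C := hlt Q (lt_of_le_of_ne hQM fun h => hq ⟨q, hqp, h ▸ IsPGroup.of_card hQ⟩) hVQ
    rw [← hqp.pow_dvd_iff_le_factorization Nat.card_pos.ne', ← hQ]
    exact card_dvd_of_le hQC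

end CoprimeAction

section Amalgam

open Subgroup

variable {H : Type} [Group H] {p : ℕ}

lemma mem_conjSub {g x : H} {L : Subgroup H} : x ∈ conjSub g L ↔ g⁻¹ * x * g ∈ L := by
  constructor
  · rintro ⟨y, hy, rfl⟩
    simpa [mul_assoc] using hy
  · exact fun h => ⟨_, h, by simp [mul_assoc]⟩

lemma conjSub_conjSub (g h : H) (L : Subgroup H) : conjSub g (conjSub h L) = conjSub (g * h) L := by
  ext x
  simp [mem_conjSub, mul_assoc]

@[simp] lemma conjSub_one (L : Subgroup H) : conjSub 1 L = L := by
  ext x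
  simp [mem_conjSub]

lemma conjSub_mono (g : H) {K L : Subgroup H} (h : K ≤ L) : conjSub g K ≤ conjSub g L :=
  map_mono h

lemma conjSub_eq_self {g : H} {L : Subgroup H} (hg : g ∈ L) : conjSub g L = L := by
  ext x
  rw [mem_conjSub, L.mul_mem_cancel_right hg, L.mul_mem_cancel_left (L.inv_mem hg)]

lemma conjSub_zpowers_le {A : Subgroup H} {a n x : H} (ha : a ∈ A) (hax : a * x = x * a) :
    conjSub n (zpowers a) ≤ conjSub (n * x) A := by
  rw [← conjSub_conjSub]
  refine conjSub_mono n ?_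
  rw [zpowers_le, mem_conjSub, mul_assoc, hax, inv_mul_cancel_left]
  exact ha

lemma conjSub_mem_apSet {g : H} {E : Subgroup H} (hE : E ∈ apSet p H) :
    conjSub g E ∈ apSet p H := by
  refine ⟨fun h => hE.1 ?_, ?_, ?_⟩
  · rw [← conjSub_one E, ← inv_mul_cancel g, ← conjSub_conjSub, h]
    exact Subgroup.map_bot _
  · rintro ⟨_, a, ha, rfl⟩ ⟨_, b, hb, rfl⟩
    exact Subtype.ext (by simpa using hE.2.mul_comm ha hb)
  · rintro ⟨_, a, ha, rfl⟩
    exact Subtype.ext (by simpa using hE.2.pow_eq_one ha)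

lemma mem_apSet_of_le {E T : Subgroup H} (hE : E ≠ ⊥) (hT : T ∈ apSet p H) (h : E ≤ T) :
    E ∈ apSet p H :=
  ⟨hE, hT.2.mono h⟩

lemma mem_inf_centralizer_singleton {N : Subgroup H} {a x : H} :
    x ∈ N ⊓ centralizer {a} ↔ x ∈ N ∧ a * x = x * a := by
  rw [mem_inf, mem_centralizer_singleton_iff, eq_comm (a := x * a)]

/-- A noncyclic elementary abelian `p`-subgroup `A` normalizing a subgroup `N` of order
prime to `p`. -/
structure IsCoprimePair (p : ℕ) (A N : Subgroup H) : Prop where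
  elem : IsElementaryAbelian p A
  noncyclic : ∃ u ∈ A, ∃ v ∈ A, u ≠ 1 ∧ v ∉ zpowers u
  le_normalizer : A ≤ normalizer (N : Set H)
  not_dvd : ¬ p ∣ Nat.card N

/-- The group `N` is the colimit of the centralizers `C_N(a)`, `1 ≠ a ∈ A`, with respect to
functions that are multiplicative on each of them. -/
def AmalgamProp (A N : Subgroup H) : Prop :=
  ∀ (Γ : Type) [Group Γ] (φ : H → Γ),
    (∀ a ∈ A, a ≠ 1 → ∀ x ∈ N, ∀ y ∈ N, a * x = x * a → a * y = y * a →
      φ (x * y) = φ x * φ y) →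
    ∃ ψ : H → Γ, (∀ x ∈ N, ∀ y ∈ N, ψ (x * y) = ψ x * ψ y) ∧
      ∀ a ∈ A, a ≠ 1 → ∀ x ∈ N, a * x = x * a → ψ x = φ x

namespace IsCoprimePair

variable {A N : Subgroup H}

lemma conj_mem (h : IsCoprimePair p A N) {a x : H} (ha : a ∈ A) (hx : x ∈ N) :
    a * x * a⁻¹ ∈ N :=
  (mem_normalizer_iff.1 (h.le_normalizer ha) x).1 hx

lemma normal (h : IsCoprimePair p A N) (hsup : A ⊔ N = ⊤) : N.Normal := by
  rw [← normalizer_eq_top_iff, eq_top_iff, ← hsup]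
  exact sup_le h.le_normalizer Subgroup.le_normalizer

lemma zpowers_mem_apSet (h : IsCoprimePair p A N) {a : H} (ha : a ∈ A) (ha1 : a ≠ 1) :
    zpowers a ∈ apSet p H :=
  ⟨by simpa using ha1, h.elem.mono ((zpowers_le).2 ha)⟩

lemma mem_apSet (h : IsCoprimePair p A N) : A ∈ apSet p H := by
  obtain ⟨u, hu, v, hv, hu1, huv⟩ := h.noncyclic
  exact ⟨fun hA => hu1 (by simpa [hA] using hu), h.elem⟩

lemma le_normalizer_inf_centralizer (h : IsCoprimePair p A N) {a : H}
    (ha : ∀ b ∈ A, a * b = b * a) : A ≤ normalizer ((N ⊓ centralizer {a} : Subgroup H) : Set H) := by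
  have key (b : H) (hb : b ∈ A) (x : H) (hx : x ∈ N ⊓ centralizer {a}) :
      b * x * b⁻¹ ∈ N ⊓ centralizer {a} := by
    rw [mem_inf_centralizer_singleton] at hx ⊢
    refine ⟨h.conj_mem hb hx.1, ?_⟩
    have hab : Commute a b := ha b hb
    exact (hab.mul_right hx.2).mul_right hab.inv_right
  refine fun b hb => mem_normalizer_iff.2 fun x => ⟨key b hb x, fun hx => ?_⟩
  simpa [mul_assoc] using key b⁻¹ (A.inv_mem hb) _ hx

variable [hp : Fact p.Prime]

lemma eq_one_of_mem (h : IsCoprimePair p A N) {x : H} (hA : x ∈ A) (hN : x ∈ N) : x = 1 := by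
  rcases (Nat.dvd_prime hp.out).1 (orderOf_dvd_of_pow_eq_one (h.elem.pow_eq_one hA)) with h1 | h1
  · exact orderOf_eq_one_iff.1 h1
  · refine absurd ?_ h.not_dvd
    rw [← h1]
    exact N.orderOf_dvd_natCard hN

lemma commute_of_conj_mem (h : IsCoprimePair p A N) {a n : H} (ha : a ∈ A) (hn : n ∈ N)
    (hna : n * a * n⁻¹ ∈ A) : a * n = n * a := by
  have h1 : n * a * n⁻¹ * a⁻¹ = 1 := by
    refine h.eq_one_of_mem (A.mul_mem hna (A.inv_mem ha)) ?_
    have := N.mul_mem hn (h.conj_mem ha (N.inv_mem hn))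
    simpa only [mul_assoc] using this
  rw [mul_inv_eq_one, mul_inv_eq_iff_eq_mul] at h1
  exact h1.symm

lemma conj_eq_conj (h : IsCoprimePair p A N) {e m n : H} (hm : m ∈ N) (hn : n ∈ N)
    (hme : m⁻¹ * e * m ∈ A) (hne : n⁻¹ * e * n ∈ A) : m⁻¹ * e * m = n⁻¹ * e * n := by
  have := h.commute_of_conj_mem hme (N.mul_mem (N.inv_mem hn) hm) (by
    convert hne using 1
    group)
  have hk : n⁻¹ * e * n = (n⁻¹ * m) * (m⁻¹ * e * m) * (n⁻¹ * m)⁻¹ := by group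
  rw [hk, ← this, mul_inv_cancel_right]

lemma exists_commuting_of_le (h : IsCoprimePair p A N) {E : Subgroup H} (hE : E ∈ apSet p H)
    {m n : H} (hm : m ∈ N) (hn : n ∈ N) (hEm : E ≤ conjSub m A) (hEn : E ≤ conjSub n A) :
    ∃ a ∈ A, a ≠ 1 ∧ a * (m⁻¹ * n) = (m⁻¹ * n) * a := by
  obtain ⟨e, he, he1⟩ := E.bot_or_exists_ne_one.resolve_left hE.1
  refine ⟨m⁻¹ * e * m, mem_conjSub.1 (hEm he), fun h1 => he1 ?_, ?_⟩
  · have : e = m * (m⁻¹ * e * m) * m⁻¹ := by group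
    rw [this, h1]
    group
  · nth_rw 2 [h.conj_eq_conj hm hn (mem_conjSub.1 (hEm he)) (mem_conjSub.1 (hEn he))]
    group

variable [Finite H]

lemma le_closure (h : IsCoprimePair p A N) {M : Subgroup H} (hM : M ≤ N)
    (hA : A ≤ normalizer (M : Set H)) :
    M ≤ closure {x | x ∈ M ∧ ∃ w ∈ A, w ≠ 1 ∧ w * x = x * w} := by
  obtain ⟨u, hu, v, hv, hu1, huv⟩ := h.noncyclic
  exact le_closure_commuting h.elem hu hv hu1 huv M hA
    fun hd => h.not_dvd (hd.trans (card_dvd_of_le hM))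

lemma exists_le_conjSub (h : IsCoprimePair p A N) (hsup : A ⊔ N = ⊤) {E : Subgroup H}
    (hE : E ∈ apSet p H) : ∃ n ∈ N, E ≤ conjSub n A := by
  have hN := h.normal hsup
  have hcompl : IsComplement' A N := by
    refine isComplement'_of_disjoint_and_mul_eq_univ ?_ ?_
    · rw [disjoint_def]
      exact fun hx hy => h.eq_one_of_mem hx hy
    · rw [← Subgroup.mul_normal, hsup, coe_top]
  obtain ⟨S, hS⟩ := (hE.2.isPGroup : IsPGroup p E).exists_le_sylow
  have hAS : ¬ p ∣ A.index := by
    rw [hcompl.symm.index_eq_card]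
    exact h.not_dvd
  obtain ⟨g, hg⟩ := MulAction.exists_smul_eq H ((h.elem.isPGroup : IsPGroup p A).toSylow hAS) S
  have hg' : g ∈ N ⊔ A := by rw [sup_comm, hsup]; trivial
  obtain ⟨n, hn, a, ha, rfl⟩ := mem_sup_of_normal_left.1 hg'
  refine ⟨n, hn, hS.trans ?_⟩
  rw [← conjSub_eq_self ha, conjSub_conjSub, ← hg]
  exact le_rfl

/-- A function on `N` that is right multiplicative for the elements of the centralizers
`C_N(a)`, `1 ≠ a ∈ A`, is multiplicative on `N`. -/
lemma mul_of_mul_commuting (h : IsCoprimePair p A N) {Γ : Type*} [Group Γ] {ψ : H → Γ}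
    (hψ : ∀ a ∈ A, a ≠ 1 → ∀ n ∈ N, ∀ x ∈ N, a * x = x * a → ψ (n * x) = ψ n * ψ x)
    {x y : H} (hx : x ∈ N) (hy : y ∈ N) : ψ (x * y) = ψ x * ψ y := by
  suffices hy' : y ∈ N ∧ ∀ x ∈ N, ψ (x * y) = ψ x * ψ y from hy'.2 x hx
  refine closure_induction (p := fun y _ => y ∈ N ∧ ∀ x ∈ N, ψ (x * y) = ψ x * ψ y)
    ?_ ?_ ?_ ?_ (h.le_closure le_rfl h.le_normalizer hy)
  · rintro y ⟨hy, a, ha, ha1, hay⟩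
    exact ⟨hy, fun x hx => hψ a ha ha1 x hx y hy hay⟩
  · obtain ⟨u, hu, v, hv, hu1, huv⟩ := h.noncyclic
    exact ⟨N.one_mem, fun x hx => hψ u hu hu1 x hx 1 N.one_mem (by simp)⟩
  · rintro y z - - ⟨hy, hy'⟩ ⟨hz, hz'⟩
    refine ⟨N.mul_mem hy hz, fun x hx => ?_⟩
    rw [← mul_assoc, hz' _ (N.mul_mem hx hy), hy' x hx, hz' y hy, mul_assoc]
  · rintro y - ⟨hy, hy'⟩
    have h1 : ψ 1 = 1 := by simpa using hy' 1 N.one_mem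
    have h2 : ψ y⁻¹ = (ψ y)⁻¹ := by
      rw [eq_inv_iff_mul_eq_one, ← hy' _ (N.inv_mem hy), inv_mul_cancel, h1]
    refine ⟨N.inv_mem hy, fun x hx => ?_⟩
    rw [h2, eq_mul_inv_iff_mul_eq, ← hy' _ (N.mul_mem hx (N.inv_mem hy)), inv_mul_cancel_right]

theorem amalgamProp_of_cocyclesTrivial (h : IsCoprimePair p A N) (hsup : A ⊔ N = ⊤)
    (htriv : CocyclesTrivial (apSet p H)) : AmalgamProp A N := by
  intro Γ _ φ hφ
  have hν' (E : Subgroup H) : ∃ n ∈ N, E ∈ apSet p H → E ≤ conjSub n A := by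
    by_cases hE : E ∈ apSet p H
    · obtain ⟨n, hn, hE'⟩ := h.exists_le_conjSub hsup hE
      exact ⟨n, hn, fun _ => hE'⟩
    · exact ⟨1, N.one_mem, fun hE' => absurd hE' hE⟩
  choose ν hνN hν using hν'
  have hmul {e k m n : H} (he : e ≠ 1) (hk : k ∈ N) (hm : m ∈ N) (hn : n ∈ N)
      (hke : k⁻¹ * e * k ∈ A) (hme : m⁻¹ * e * m ∈ A) (hne : n⁻¹ * e * n ∈ A) :
      φ (k⁻¹ * n) = φ (k⁻¹ * m) * φ (m⁻¹ * n) := by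
    have hcomm {k m : H} (hk : k ∈ N) (hm : m ∈ N) (hke : k⁻¹ * e * k ∈ A)
        (hme : m⁻¹ * e * m ∈ A) :
        (k⁻¹ * e * k) * (k⁻¹ * m) = (k⁻¹ * m) * (k⁻¹ * e * k) := by
      nth_rw 2 [h.conj_eq_conj hk hm hke hme]
      group
    rw [← hφ _ hke _ _ (N.mul_mem (N.inv_mem hk) hm) _ (N.mul_mem (N.inv_mem hm) hn)
      (hcomm hk hm hke hme) (by rw [h.conj_eq_conj hk hm hke hme]; exact hcomm hm hn hme hne)]
    · group
    · intro h1
      refine he ?_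
      have : e = k * (k⁻¹ * e * k) * k⁻¹ := by group
      rw [this, h1]
      group
  obtain ⟨f, hf⟩ := htriv Γ (fun E E' => φ ((ν E)⁻¹ * ν E')) (by
    intro E hE E' hE' E'' hE'' h1 h2
    obtain ⟨e, he, he1⟩ := E.bot_or_exists_ne_one.resolve_left hE.1
    exact (hmul (e := e) he1 (hνN _) (hνN _) (hνN _)
      (mem_conjSub.1 (hν _ hE he)) (mem_conjSub.1 (hν _ hE' (h1 he)))
      (mem_conjSub.1 (hν _ hE'' (h2 (h1 he))))).symm)
  let G (n : H) : Γ := f (conjSub n A) * φ ((ν (conjSub n A))⁻¹ * n)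
  have hG {n a : H} (hn : n ∈ N) {E : Subgroup H} (hE : E ∈ apSet p H)
      (ha : a ∈ E) (ha1 : a ≠ 1) (hEn : E ≤ conjSub n A) :
      G n = f E * φ ((ν E)⁻¹ * n) := by
    have hT : conjSub n A ∈ apSet p H := conjSub_mem_apSet h.mem_apSet
    have h1 := hf E hE _ hT hEn
    rw [hmul ha1 (hνN E) (hνN (conjSub n A)) hn (mem_conjSub.1 (hν _ hE ha))
      (mem_conjSub.1 (hν _ hT (hEn ha))) (mem_conjSub.1 (hEn ha))]
    simp only [G]
    rw [h1]
    group
  have hGφ {a : H} (ha : a ∈ A) (ha1 : a ≠ 1) {n : H} (hn : n ∈ N) {x : H} (hx : x ∈ N)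
      (hax : a * x = x * a) : G (n * x) = G n * φ x := by
    have hE : conjSub n (zpowers a) ∈ apSet p H := conjSub_mem_apSet (h.zpowers_mem_apSet ha ha1)
    have hle : zpowers a ≤ A := (zpowers_le).2 ha
    have hle' : zpowers a ≤ conjSub x A := by
      rw [zpowers_le, mem_conjSub, mul_assoc, hax, inv_mul_cancel_left]
      exact ha
    have he1 : n * a * n⁻¹ ≠ 1 := by simpa using ha1
    have he : n * a * n⁻¹ ∈ conjSub n (zpowers a) := by
      rw [mem_conjSub]
      simp [mul_assoc]
    have h1 := conjSub_mono n hle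
    have h2 : conjSub n (zpowers a) ≤ conjSub (n * x) A := by
      rw [← conjSub_conjSub]
      exact conjSub_mono n hle'
    have h3 := hmul he1 (hνN _) hn (N.mul_mem hn hx) (mem_conjSub.1 (hν _ hE he))
      (mem_conjSub.1 (h1 he)) (mem_conjSub.1 (h2 he))
    rw [hG (N.mul_mem hn hx) hE he he1 h2, hG hn hE he he1 h1, h3, inv_mul_cancel_left, mul_assoc]
  have hψφ {a : H} (ha : a ∈ A) (ha1 : a ≠ 1) {x : H} (hx : x ∈ N)
      (hax : a * x = x * a) : (G 1)⁻¹ * G x = φ x := by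
    rw [inv_mul_eq_iff_eq_mul, ← hGφ ha ha1 N.one_mem hx hax, one_mul]
  refine ⟨fun n => (G 1)⁻¹ * G n, fun x hx y hy => ?_, fun a ha ha1 x hx hax => hψφ ha ha1 hx hax⟩
  refine h.mul_of_mul_commuting (ψ := fun n => (G 1)⁻¹ * G n) ?_ hx hy
  intro a ha ha1 n hn x hx hax
  rw [hGφ ha ha1 hn hx hax, hψφ ha ha1 hx hax]
  exact (mul_assoc _ _ _).symm

/-- Induction on `N` by right multiplication with elements of the centralizers
`C_N(a)`, `1 ≠ a ∈ A`. -/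
lemma induction_right (h : IsCoprimePair p A N) {P : H → Prop} (one : P 1)
    (mul : ∀ n ∈ N, P n → ∀ a ∈ A, a ≠ 1 → ∀ x ∈ N, a * x = x * a → P (n * x))
    {n : H} (hn : n ∈ N) : P n := by
  suffices h' : n ∈ N ∧ P n from h'.2
  refine closure_induction_right (p := fun n _ => n ∈ N ∧ P n) ⟨N.one_mem, one⟩ ?_ ?_
    (h.le_closure le_rfl h.le_normalizer hn)
  · rintro n - x ⟨hx, a, ha, ha1, hax⟩ ⟨hn, hP⟩
    exact ⟨N.mul_mem hn hx, mul n hn hP a ha ha1 x hx hax⟩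
  · rintro n - x ⟨hx, a, ha, ha1, hax⟩ ⟨hn, hP⟩
    exact ⟨N.mul_mem hn (N.inv_mem hx), mul n hn hP a ha ha1 _ (N.inv_mem hx)
      (Commute.inv_right hax)⟩

theorem cocyclesTrivial_of_amalgamProp (h : IsCoprimePair p A N) (hsup : A ⊔ N = ⊤)
    (hamalg : AmalgamProp A N) : CocyclesTrivial (apSet p H) := by
  intro Γ _ c hc
  have hT (n : H) : conjSub n A ∈ apSet p H := conjSub_mem_apSet h.mem_apSet
  let η (m n : H) : Γ := (c (conjSub m A ⊓ conjSub n A) (conjSub m A))⁻¹ *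
    c (conjSub m A ⊓ conjSub n A) (conjSub n A)
  have hη_symm (m n : H) : η m n * η n m = 1 := by
    simp only [η, inf_comm (conjSub n A)]
    group
  have hη {m n : H} {E : Subgroup H} (hE : E ∈ apSet p H) (hm : E ≤ conjSub m A)
      (hn : E ≤ conjSub n A) : η m n = (c E (conjSub m A))⁻¹ * c E (conjSub n A) := by
    have hinf : conjSub m A ⊓ conjSub n A ∈ apSet p H :=
      mem_apSet_of_le (fun h0 => hE.1 (le_bot_iff.1 (h0 ▸ le_inf hm hn))) (hT m) inf_le_left
    rw [← hc E hE _ hinf _ (hT m) (le_inf hm hn) inf_le_left,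
      ← hc E hE _ hinf _ (hT n) (le_inf hm hn) inf_le_right]
    simp only [η]
    group
  have hη_mul {a : H} (ha : a ∈ A) (ha1 : a ≠ 1) {n x y : H} (hx : a * x = x * a)
      (hy : a * y = y * a) : η n (n * x) * η (n * x) (n * x * y) = η n (n * x * y) := by
    have hE : conjSub n (zpowers a) ∈ apSet p H := conjSub_mem_apSet (h.zpowers_mem_apSet ha ha1)
    have h1 : conjSub n (zpowers a) ≤ conjSub n A := conjSub_mono n ((zpowers_le).2 ha)
    have h2 : conjSub n (zpowers a) ≤ conjSub (n * x) A := conjSub_zpowers_le ha hx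
    have h3 : conjSub n (zpowers a) ≤ conjSub (n * x * y) A := by
      rw [mul_assoc]
      exact conjSub_zpowers_le ha (Commute.mul_right hx hy)
    rw [hη hE h1 h2, hη hE h2 h3, hη hE h1 h3]
    group
  let φ (x : H) : Equiv.Perm (H × Γ) :=
    { toFun := fun v => (v.1 * x⁻¹, v.2 * η v.1 (v.1 * x⁻¹))
      invFun := fun v => (v.1 * x, v.2 * η v.1 (v.1 * x))
      left_inv := fun v => by simp [mul_assoc, hη_symm]
      right_inv := fun v => by simp [mul_assoc, hη_symm] }
  obtain ⟨ψ, hψ, hψφ⟩ := hamalg (Equiv.Perm (H × Γ)) φ (by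
    intro a ha ha1 x hx y hy hax hay
    ext1 v
    change (v.1 * (x * y)⁻¹, v.2 * η v.1 (v.1 * (x * y)⁻¹)) =
      (v.1 * y⁻¹ * x⁻¹, v.2 * η v.1 (v.1 * y⁻¹) * η (v.1 * y⁻¹) (v.1 * y⁻¹ * x⁻¹))
    rw [mul_assoc v.2, hη_mul ha ha1 (Commute.inv_right hay) (Commute.inv_right hax),
      mul_inv_rev, mul_assoc])
  let F (n : H) : Γ := (ψ n⁻¹ (1, 1)).2
  have hstep {n : H} (hn : n ∈ N) {a : H} (ha : a ∈ A) (ha1 : a ≠ 1) {x : H} (hx : x ∈ N)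
      (hax : a * x = x * a) (hn1 : (ψ n⁻¹ (1, 1)).1 = n) :
      ψ (n * x)⁻¹ (1, 1) = (n * x, F n * η n (n * x)) := by
    rw [mul_inv_rev, hψ _ (N.inv_mem hx) _ (N.inv_mem hn),
      hψφ a ha ha1 _ (N.inv_mem hx) (Commute.inv_right hax), Equiv.Perm.mul_apply]
    change ((ψ n⁻¹ (1, 1)).1 * x⁻¹⁻¹, F n * η (ψ n⁻¹ (1, 1)).1 ((ψ n⁻¹ (1, 1)).1 * x⁻¹⁻¹)) = _
    rw [hn1, inv_inv]
  have hfst {n : H} (hn : n ∈ N) : (ψ n⁻¹ (1, 1)).1 = n := by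
    refine h.induction_right (P := fun n => (ψ n⁻¹ (1, 1)).1 = n) ?_ ?_ hn
    · have : ψ 1 = 1 := by simpa using hψ 1 N.one_mem 1 N.one_mem
      simp [this]
    · intro n hn hn1 a ha ha1 x hx hax
      rw [hstep hn ha ha1 hx hax hn1]
  have hF {m n : H} (hm : m ∈ N) (hn : n ∈ N) {E : Subgroup H} (hE : E ∈ apSet p H)
      (hEm : E ≤ conjSub m A) (hEn : E ≤ conjSub n A) :
      F n * (c E (conjSub n A))⁻¹ = F m * (c E (conjSub m A))⁻¹ := by
    obtain ⟨a, ha, ha1, hax⟩ := h.exists_commuting_of_le hE hm hn hEm hEn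
    have h1 := congrArg Prod.snd
      (hstep hm ha ha1 (N.mul_mem (N.inv_mem hm) hn) hax (hfst hm))
    rw [mul_inv_cancel_left, hη hE hEm hEn] at h1
    change F n = _ at h1
    rw [h1]
    group
  have hν' (E : Subgroup H) : ∃ n ∈ N, E ∈ apSet p H → E ≤ conjSub n A := by
    by_cases hE : E ∈ apSet p H
    · obtain ⟨n, hn, hE'⟩ := h.exists_le_conjSub hsup hE
      exact ⟨n, hn, fun _ => hE'⟩
    · exact ⟨1, N.one_mem, fun hE' => absurd hE' hE⟩
  choose ν hνN hν using hν'
  refine ⟨fun E => F (ν E) * (c E (conjSub (ν E) A))⁻¹, fun E hE E' hE' hle => ?_⟩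
  have h1 := hF (hνN E') (hνN E) hE (hle.trans (hν E' hE')) (hν E hE)
  simp only
  rw [h1, ← hc E hE E' hE' _ (hT _) hle (hν E' hE')]
  group

lemma eqvGen_apSet (h : IsCoprimePair p A N) (hsup : A ⊔ N = ⊤) (E E' : apSet p H) :
    Relation.EqvGen (fun a b : apSet p H => a ≤ b) E E' := by
  have hT (n : H) : conjSub n A ∈ apSet p H := conjSub_mem_apSet h.mem_apSet
  have h1 {n : H} (hn : n ∈ N) : Relation.EqvGen (fun a b : apSet p H => a ≤ b)
      ⟨_, hT 1⟩ ⟨_, hT n⟩ := by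
    refine h.induction_right (P := fun n => Relation.EqvGen (fun a b : apSet p H => a ≤ b)
      ⟨_, hT 1⟩ ⟨_, hT n⟩) (.refl _) ?_ hn
    intro n hn ih a ha ha1 x hx hax
    have hE : conjSub n (zpowers a) ∈ apSet p H := conjSub_mem_apSet (h.zpowers_mem_apSet ha ha1)
    refine (ih.trans _ _ _ (.symm (⟨_, hE⟩ : apSet p H) _ (.rel _ _ ?_))).trans _ _ _
      (.rel _ _ ?_)
    · exact conjSub_mono n ((zpowers_le).2 ha)
    · exact conjSub_zpowers_le ha hax
  have h2 (E : apSet p H) : Relation.EqvGen (fun a b : apSet p H => a ≤ b) ⟨_, hT 1⟩ E := by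
    obtain ⟨n, hn, hE⟩ := h.exists_le_conjSub hsup E.2
    exact (h1 hn).trans _ _ _ (.symm _ _ (.rel _ _ hE))
  exact ((h2 E).symm).trans _ _ _ (h2 E')

lemma amalgamProp_of_le (h : IsCoprimePair p A N) {A' : Subgroup H} (hle : A ≤ A')
    (hA' : IsElementaryAbelian p A') (hamalg : AmalgamProp A N) : AmalgamProp A' N := by
  intro Γ _ φ hφ
  obtain ⟨ψ, hψ, hψφ⟩ := hamalg Γ φ fun a ha => hφ a (hle ha)
  have hψ1 : ψ 1 = 1 := by simpa using hψ 1 N.one_mem 1 N.one_mem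
  refine ⟨ψ, hψ, fun a ha ha1 x hx hax => ?_⟩
  have hφ1 : φ 1 = 1 := by simpa using hφ a ha ha1 1 N.one_mem 1 N.one_mem
  let C := N ⊓ centralizer {a}
  have hxC {x : H} : x ∈ C ↔ x ∈ N ∧ a * x = x * a := mem_inf_centralizer_singleton
  have hAC : A ≤ normalizer (C : Set H) :=
    h.le_normalizer_inf_centralizer fun b hb => hA'.mul_comm ha (hle hb)
  suffices h' : x ∈ C ∧ ψ x = φ x from h'.2
  refine closure_induction (p := fun x _ => x ∈ C ∧ ψ x = φ x)
    ?_ ⟨C.one_mem, hψ1.trans hφ1.symm⟩ ?_ ?_ (h.le_closure inf_le_left hAC (hxC.2 ⟨hx, hax⟩))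
  · rintro x ⟨hx, b, hb, hb1, hbx⟩
    exact ⟨hx, hψφ b hb hb1 x (hxC.1 hx).1 hbx⟩
  · rintro x y - - ⟨hx, hx'⟩ ⟨hy, hy'⟩
    refine ⟨C.mul_mem hx hy, ?_⟩
    rw [hxC] at hx hy
    rw [hψ x hx.1 y hy.1, hφ a ha ha1 x hx.1 y hy.1 hx.2 hy.2, hx', hy']
  · rintro x - ⟨hx, hx'⟩
    have hxi := C.inv_mem hx
    refine ⟨hxi, ?_⟩
    rw [hxC] at hx hxi
    have h1 := hψ x hx.1 x⁻¹ hxi.1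
    have h2 := hφ a ha ha1 x hx.1 x⁻¹ hxi.1 hx.2 hxi.2
    rw [mul_inv_cancel, hψ1] at h1
    rw [mul_inv_cancel, hφ1, ← hx', h1] at h2
    exact mul_left_cancel h2

end IsCoprimePair

lemma amalgamProp_of_commute {A N : Subgroup H} {a : H} (ha : a ∈ A) (ha1 : a ≠ 1)
    (hN : ∀ x ∈ N, a * x = x * a) : AmalgamProp A N :=
  fun _ _ φ hφ => ⟨φ, fun x hx y hy => hφ a ha ha1 x hx y hy (hN x hx) (hN y hy),
    fun _ _ _ _ _ _ => rfl⟩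

lemma sup_eq_range_of_commute {N M : Subgroup H} (hcomm : ∀ x ∈ N, ∀ y ∈ M, x * y = y * x) :
    N ⊔ M = (MonoidHom.noncommCoprod N.subtype M.subtype
      fun x y => (hcomm x x.2 y y.2 : Commute (x : H) y)).range :=
  ((MonoidHom.noncommCoprod_range _ _ _).trans (by rw [range_subtype, range_subtype])).symm

lemma mem_sup_iff_of_commute {N M : Subgroup H} (hcomm : ∀ x ∈ N, ∀ y ∈ M, x * y = y * x) {z : H} :
    z ∈ N ⊔ M ↔ ∃ x ∈ N, ∃ y ∈ M, x * y = z := by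
  rw [sup_eq_range_of_commute hcomm]
  constructor
  · rintro ⟨⟨x, y⟩, rfl⟩
    exact ⟨x, x.2, y, y.2, rfl⟩
  · rintro ⟨x, hx, y, hy, rfl⟩
    exact ⟨(⟨x, hx⟩, ⟨y, hy⟩), rfl⟩

lemma card_sup_dvd_of_commute {N M : Subgroup H} (hcomm : ∀ x ∈ N, ∀ y ∈ M, x * y = y * x) :
    Nat.card (N ⊔ M : Subgroup H) ∣ Nat.card N * Nat.card M := by
  rw [sup_eq_range_of_commute hcomm, ← Nat.card_prod]
  exact Subgroup.card_range_dvd _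

lemma mem_or_inf_zpowers_eq_bot [hp : Fact p.Prime] {x : H} (hx : x ^ p = 1) (S : Subgroup H) :
    x ∈ S ∨ S ⊓ zpowers x = ⊥ := by
  rcases (Nat.dvd_prime hp.out).1 (orderOf_dvd_of_pow_eq_one hx) with h1 | h1
  · rw [orderOf_eq_one_iff.1 h1]
    exact .inl S.one_mem
  · have : Fact (Nat.card (zpowers x)).Prime := ⟨by rw [Nat.card_zpowers, h1]; exact hp.out⟩
    rcases (S.subgroupOf (zpowers x)).eq_bot_or_eq_top_of_prime_card with h2 | h2
    · right
      rwa [subgroupOf_eq_bot, disjoint_iff] at h2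
    · left
      rw [subgroupOf_eq_top] at h2
      exact h2 (mem_zpowers x)

lemma IsElementaryAbelian.exists_noncyclic [hp : Fact p.Prime] {A : Subgroup H}
    (hA : IsElementaryAbelian p A) (hcard : p < Nat.card A) :
    ∃ u ∈ A, ∃ v ∈ A, u ≠ 1 ∧ v ∉ zpowers u := by
  have h1 : A ≠ ⊥ := by
    rintro rfl
    rw [card_bot] at hcard
    exact absurd hcard hp.out.one_le.not_gt
  obtain ⟨u, hu, hu1⟩ := A.bot_or_exists_ne_one.resolve_left h1
  refine ⟨u, hu, ?_⟩
  by_contra! hcon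
  have hle : A ≤ zpowers u := fun v hv => hcon v hv hu1
  have hfin : Finite (zpowers u) := isOfFinOrder_iff_pow_eq_one.2
    ⟨p, hp.out.pos, hA.pow_eq_one hu⟩ |>.finite_zpowers
  have h2 := Nat.card_le_card_of_injective _ (inclusion_injective hle)
  rw [Nat.card_zpowers] at h2
  have h3 := orderOf_le_of_pow_eq_one hp.out.pos (hA.pow_eq_one hu)
  omega

/-- Cyclic subgroups of elementary abelian groups of rank at least three have noncyclic
complements. -/
lemma IsElementaryAbelian.exists_complement [hp : Fact p.Prime] [Finite H] {A : Subgroup H}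
    (hA : IsElementaryAbelian p A) (hcard : p ^ 2 < Nat.card A) {a : H} (ha : a ∈ A) :
    ∃ D ≤ A, D ⊓ zpowers a = ⊥ ∧ ∃ u ∈ D, ∃ v ∈ D, u ≠ 1 ∧ v ∉ zpowers u := by
  obtain ⟨D, ⟨hDA, hDa⟩, hD⟩ := (Set.toFinite {D : Subgroup H | D ≤ A ∧ D ⊓ zpowers a = ⊥}).exists_maximal
    ⟨⊥, bot_le, bot_inf_eq _⟩
  have hzA : zpowers a ≤ A := (zpowers_le).2 ha
  have hcomm {S T : Subgroup H} (hS : S ≤ A) (hT : T ≤ A) (x) (hx : x ∈ S) (y) (hy : y ∈ T) :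
      x * y = y * x := hA.mul_comm (hS hx) (hT hy)
  have hsup : A ≤ D ⊔ zpowers a := by
    intro x hx
    have hzx : zpowers x ≤ A := (zpowers_le).2 hx
    refine (mem_or_inf_zpowers_eq_bot (hA.pow_eq_one hx) _).elim id fun hbot => ?_
    have hle : D ⊔ zpowers x ≤ D := by
      refine hD ⟨sup_le hDA hzx, ?_⟩ le_sup_left
      rw [eq_bot_iff]
      rintro w ⟨hw, hwa⟩
      obtain ⟨d, hd, y, hy, rfl⟩ := (mem_sup_iff_of_commute (hcomm hDA hzx)).1 hw
      have hy1 : y ∈ D ⊔ zpowers a := by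
        rw [← inv_mul_cancel_left d y]
        exact mul_mem (mem_sup_left (D.inv_mem hd)) (mem_sup_right hwa)
      have hy2 : y ∈ (D ⊔ zpowers a) ⊓ zpowers x := ⟨hy1, hy⟩
      rw [hbot, mem_bot] at hy2
      rw [← hDa]
      refine ⟨?_, hwa⟩
      rw [hy2, mul_one]
      exact hd
    have hxD : x ∈ (D ⊔ zpowers a) ⊓ zpowers x :=
      ⟨mem_sup_left (hle (mem_sup_right (mem_zpowers x))), mem_zpowers x⟩
    rw [hbot, mem_bot] at hxD
    rw [hxD]
    exact one_mem _
  refine ⟨D, hDA, hDa, (hA.mono hDA).exists_noncyclic ?_⟩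
  have h1 := Nat.le_of_dvd (Nat.mul_pos Nat.card_pos Nat.card_pos)
    (card_sup_dvd_of_commute (hcomm hDA hzA))
  have h2 := Nat.card_le_card_of_injective _ (inclusion_injective hsup)
  rw [Nat.card_zpowers] at h1
  have h3 := orderOf_le_of_pow_eq_one hp.out.pos (hA.pow_eq_one ha)
  by_contra! h4
  have h5 := Nat.mul_le_mul h4 h3
  rw [← sq] at h5
  omega

theorem AmalgamProp.sup [Fact p.Prime] [Finite H] {A N M : Subgroup H} (hN : IsCoprimePair p A N)
    (hM : IsCoprimePair p A M) (hcard : p ^ 2 < Nat.card A)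
    (hcomm : ∀ x ∈ N, ∀ y ∈ M, x * y = y * x) (hdisj : N ⊓ M = ⊥)
    (hNa : AmalgamProp A N) (hMa : AmalgamProp A M) : AmalgamProp A (N ⊔ M) := by
  intro Γ _ φ hφ
  obtain ⟨ψ₁, hψ₁, hψφ₁⟩ := hNa Γ φ fun a ha ha1 x hx y hy =>
    hφ a ha ha1 x (mem_sup_left hx) y (mem_sup_left hy)
  obtain ⟨ψ₂, hψ₂, hψφ₂⟩ := hMa Γ φ fun a ha ha1 x hx y hy =>
    hφ a ha ha1 x (mem_sup_right hx) y (mem_sup_right hy)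
  have one_of_mul {ψ : H → Γ} {N : Subgroup H}
      (hψ : ∀ x ∈ N, ∀ y ∈ N, ψ (x * y) = ψ x * ψ y) : ψ 1 = 1 := by
    simpa using hψ 1 N.one_mem 1 N.one_mem
  have inv_of_mul {ψ : H → Γ} {N : Subgroup H}
      (hψ : ∀ x ∈ N, ∀ y ∈ N, ψ (x * y) = ψ x * ψ y) {x : H} (hx : x ∈ N) :
      ψ x⁻¹ = (ψ x)⁻¹ := by
    rw [eq_inv_iff_mul_eq_one, ← hψ _ (N.inv_mem hx) _ hx, inv_mul_cancel, one_of_mul hψ]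
  have commute_of_closure {ψ : H → Γ} {N M : Subgroup H}
      (hψ : ∀ x ∈ N, ∀ y ∈ N, ψ (x * y) = ψ x * ψ y) (hMN : M ≤ N) {P : H → Prop}
      (hcl : M ≤ closure {x | x ∈ M ∧ P x}) {g : Γ}
      (hg : ∀ x ∈ M, P x → Commute (ψ x) g) {x : H} (hx : x ∈ M) : Commute (ψ x) g := by
    suffices h' : x ∈ N ∧ Commute (ψ x) g from h'.2
    refine closure_induction (p := fun x _ => x ∈ N ∧ Commute (ψ x) g) ?_ ?_ ?_ ?_ (hcl hx)
    · exact fun x hx => ⟨hMN hx.1, hg x hx.1 hx.2⟩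
    · exact ⟨N.one_mem, by rw [one_of_mul hψ]; exact Commute.one_left g⟩
    · rintro x y - - ⟨hx, hx'⟩ ⟨hy, hy'⟩
      exact ⟨N.mul_mem hx hy, by rw [hψ x hx y hy]; exact hx'.mul_left hy'⟩
    · rintro x - ⟨hx, hx'⟩
      exact ⟨N.inv_mem hx, by rw [inv_of_mul hψ hx]; exact hx'.inv_left⟩
  have hψc {x y : H} (hx : x ∈ N) (hy : y ∈ M) : Commute (ψ₁ x) (ψ₂ y) := by
    refine commute_of_closure hψ₁ le_rfl (hN.le_closure le_rfl hN.le_normalizer) ?_ hx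
    rintro x hx ⟨a, ha, ha1, hax⟩
    obtain ⟨D, hDA, hDa, u, hu, v, hv, hu1, huv⟩ := hN.elem.exists_complement hcard ha
    have hDN : IsCoprimePair p D N := ⟨hN.elem.mono hDA, ⟨u, hu, v, hv, hu1, huv⟩,
      hDA.trans hN.le_normalizer, hN.not_dvd⟩
    refine commute_of_closure (M := N ⊓ centralizer {a}) hψ₁ inf_le_left
      (hDN.le_closure inf_le_left (hDN.le_normalizer_inf_centralizer fun b hb =>
        hN.elem.mul_comm ha (hDA hb))) ?_ (mem_inf_centralizer_singleton.2 ⟨hx, hax⟩)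
    rintro x hx ⟨w, hw, hw1, hwx⟩
    rw [mem_inf_centralizer_singleton] at hx
    have haw : w ∉ zpowers a := fun h => hw1 (by
      have : w ∈ D ⊓ zpowers a := ⟨hw, h⟩
      rwa [hDa, mem_bot] at this)
    have hE : closure {a, w} ≤ A := by
      rw [closure_le]
      rintro _ (rfl | rfl)
      exacts [ha, hDA hw]
    have hEM : IsCoprimePair p (closure {a, w}) M := ⟨hM.elem.mono hE,
      ⟨a, subset_closure (by simp), w, subset_closure (by simp), ha1, haw⟩,
      hE.trans hM.le_normalizer, hM.not_dvd⟩
    refine (commute_of_closure hψ₂ le_rfl (hEM.le_closure le_rfl hEM.le_normalizer) ?_ hy).symm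
    rintro y hy ⟨e, he, he1, hey⟩
    have hex : e * x = x * e := by
      have : closure {a, w} ≤ centralizer {x} := by
        rw [closure_le]
        rintro _ (rfl | rfl)
        · exact mem_centralizer_singleton_iff.2 hx.2
        · exact mem_centralizer_singleton_iff.2 hwx
      exact mem_centralizer_singleton_iff.1 (this he)
    rw [hψφ₁ a ha ha1 x hx.1 hx.2, hψφ₂ e (hE he) he1 y hy hey]
    have h1 := hφ e (hE he) he1 x (mem_sup_left hx.1) y (mem_sup_right hy) hex hey
    have h2 := hφ e (hE he) he1 y (mem_sup_right hy) x (mem_sup_left hx.1) hey hex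
    rw [hcomm x hx.1 y hy, h2] at h1
    exact h1
  have huniq {x x' y y' : H} (hx : x ∈ N) (hx' : x' ∈ N) (hy : y ∈ M) (hy' : y' ∈ M)
      (h : x * y = x' * y') : x = x' ∧ y = y' := by
    have h1 : x'⁻¹ * x = y' * y⁻¹ := by
      rw [eq_mul_inv_iff_mul_eq, mul_assoc, h, inv_mul_cancel_left]
    have h2 : x'⁻¹ * x ∈ N ⊓ M :=
      ⟨N.mul_mem (N.inv_mem hx') hx, h1 ▸ M.mul_mem hy' (M.inv_mem hy)⟩
    rw [hdisj, mem_bot, inv_mul_eq_one] at h2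
    subst h2
    exact ⟨rfl, mul_left_cancel h⟩
  have hdec (z : H) : ∃ v : H × H, z ∈ N ⊔ M → v.1 ∈ N ∧ v.2 ∈ M ∧ v.1 * v.2 = z := by
    by_cases hz : z ∈ N ⊔ M
    · obtain ⟨x, hx, y, hy, rfl⟩ := (mem_sup_iff_of_commute hcomm).1 hz
      exact ⟨(x, y), fun _ => ⟨hx, hy, rfl⟩⟩
    · exact ⟨1, fun h => absurd h hz⟩
  choose d hd using hdec
  let ψ (z : H) : Γ := ψ₁ (d z).1 * ψ₂ (d z).2
  have hψ {x y : H} (hx : x ∈ N) (hy : y ∈ M) : ψ (x * y) = ψ₁ x * ψ₂ y := by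
    obtain ⟨h1, h2, h3⟩ := hd (x * y) (mul_mem (mem_sup_left hx) (mem_sup_right hy))
    obtain ⟨h4, h5⟩ := huniq h1 hx h2 hy h3
    simp only [ψ, h4, h5]
  refine ⟨ψ, fun z hz z' hz' => ?_, fun a ha ha1 z hz haz => ?_⟩
  · obtain ⟨x, hx, y, hy, rfl⟩ := (mem_sup_iff_of_commute hcomm).1 hz
    obtain ⟨x', hx', y', hy', rfl⟩ := (mem_sup_iff_of_commute hcomm).1 hz'
    have h1 : x * y * (x' * y') = (x * x') * (y * y') :=
      Commute.mul_mul_mul_comm (hcomm x' hx' y hy).symm x y'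
    rw [h1, hψ (N.mul_mem hx hx') (M.mul_mem hy hy'), hψ hx hy, hψ hx' hy', hψ₁ x hx x' hx',
      hψ₂ y hy y' hy']
    exact (Commute.mul_mul_mul_comm (hψc hx' hy).symm _ _).symm
  · obtain ⟨x, hx, y, hy, rfl⟩ := (mem_sup_iff_of_commute hcomm).1 hz
    have h1 : (a * x * a⁻¹) * (a * y * a⁻¹) = x * y := by
      rw [← mul_inv_eq_iff_eq_mul] at haz
      rw [← haz]
      group
    obtain ⟨h2, h3⟩ := huniq (hN.conj_mem ha hx) hx (hM.conj_mem ha hy) hy h1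
    rw [mul_inv_eq_iff_eq_mul] at h2 h3
    rw [hψ hx hy, hψφ₁ a ha ha1 x hx h2, hψφ₂ a ha ha1 y hy h3,
      hφ a ha ha1 x (mem_sup_left hx) y (mem_sup_right hy) h2 h3]

lemma commute_of_mem_sSup {S : Set (Subgroup H)} {z : H} (h : ∀ K ∈ S, ∀ x ∈ K, z * x = x * z)
    {x : H} (hx : x ∈ sSup S) : z * x = x * z := by
  have : sSup S ≤ centralizer {z} :=
    sSup_le fun K hK x hx => mem_centralizer_singleton_iff.2 (h K hK x hx).symm
  exact (mem_centralizer_singleton_iff.1 (this hx)).symm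

lemma le_normalizer_sSup {B : Subgroup H} {S : Set (Subgroup H)}
    (h : ∀ b ∈ B, ∀ K ∈ S, conjSub b K ∈ S) : B ≤ normalizer ((sSup S : Subgroup H) : Set H) := by
  have key (b : H) (hb : b ∈ B) (x : H) (hx : x ∈ sSup S) : b * x * b⁻¹ ∈ sSup S := by
    have : sSup S ≤ (sSup S).comap (MulAut.conj b).toMonoidHom := sSup_le fun K hK x hx =>
      (le_sSup (h b hb K hK) : conjSub b K ≤ sSup S) ⟨x, hx, rfl⟩
    exact this hx
  refine fun b hb => mem_normalizer_iff.2 fun x => ⟨key b hb x, fun hx => ?_⟩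
  simpa [mul_assoc] using key b⁻¹ (B.inv_mem hb) _ hx

/-- A family of pairwise commuting subgroups generating a subgroup with trivial centralizer. -/
structure IsComponentFamily (𝒦 : Set (Subgroup H)) : Prop where
  commute : ∀ K ∈ 𝒦, ∀ K' ∈ 𝒦, K ≠ K' → ∀ x ∈ K, ∀ y ∈ K', x * y = y * x
  centralizer_eq_bot : centralizer ((sSup 𝒦 : Subgroup H) : Set H) = ⊥

namespace IsComponentFamily

variable {𝒦 S T : Set (Subgroup H)}

lemma commute_sSup (h : IsComponentFamily 𝒦) (hS : S ⊆ 𝒦) (hT : T ⊆ 𝒦) (hST : Disjoint S T) :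
    ∀ x ∈ sSup S, ∀ y ∈ sSup T, x * y = y * x := fun _ hx _ hy =>
  commute_of_mem_sSup (fun K' hK' y hy => (commute_of_mem_sSup (fun K hK x hx =>
    (h.commute K (hS hK) K' (hT hK') (hST.ne_of_mem hK hK') x hx y hy).symm) hx).symm) hy

lemma eq_one_of_commute (h : IsComponentFamily 𝒦) {z : H}
    (hz : ∀ K ∈ 𝒦, ∀ x ∈ K, z * x = x * z) : z = 1 := by
  rw [← mem_bot, ← h.centralizer_eq_bot, mem_centralizer_iff]
  exact fun x hx => (commute_of_mem_sSup hz hx).symm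

lemma commute_of_mem_sSup_of_notMem (h : IsComponentFamily 𝒦) (hS : S ⊆ 𝒦) {K : Subgroup H}
    (hK : K ∈ 𝒦) (hKS : K ∉ S) {z x : H} (hz : z ∈ sSup S) (hx : x ∈ K) : z * x = x * z :=
  h.commute_sSup hS (Set.singleton_subset_iff.2 hK) (Set.disjoint_singleton_right.2 hKS) z hz x
    (by rwa [sSup_singleton])

/-- The center of a product of components is trivial. -/
lemma eq_one_of_mem_of_commute (h : IsComponentFamily 𝒦) (hS : S ⊆ 𝒦) {z : H} (hz : z ∈ sSup S)
    (hzS : ∀ x ∈ sSup S, z * x = x * z) : z = 1 :=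
  h.eq_one_of_commute fun K hK x hx => by
    by_cases hKS : K ∈ S
    · exact hzS x (le_sSup hKS hx)
    · exact h.commute_of_mem_sSup_of_notMem hS hK hKS hz hx

lemma sSup_inf_sSup (h : IsComponentFamily 𝒦) (hS : S ⊆ 𝒦) (hT : T ⊆ 𝒦) (hST : Disjoint S T) :
    sSup S ⊓ sSup T = ⊥ := by
  rw [eq_bot_iff]
  rintro z ⟨hzS, hzT⟩
  exact mem_bot.2 (h.eq_one_of_mem_of_commute hS hzS fun x hx =>
    (h.commute_sSup hS hT hST x hx z hzT).symm)

lemma not_dvd_card_sSup [hp : Fact p.Prime] [Finite H] (h : IsComponentFamily 𝒦)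
    (hcard : ∀ K ∈ 𝒦, ¬ p ∣ Nat.card K) (hS : S ⊆ 𝒦) :
    ¬ p ∣ Nat.card (sSup S : Subgroup H) := by
  induction S, S.toFinite using Set.Finite.induction_on with
  | empty => simpa using hp.out.ne_one
  | @insert K S hKS _ ih =>
    rw [Set.insert_subset_iff] at hS
    rw [sSup_insert]
    intro hdvd
    have hcomm : ∀ x ∈ K, ∀ y ∈ sSup S, x * y = y * x := fun x hx y hy =>
      (h.commute_of_mem_sSup_of_notMem hS.2 hS.1 hKS hy hx).symm
    rcases hp.out.dvd_mul.1 (hdvd.trans (card_sup_dvd_of_commute hcomm)) with h1 | h1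
    exacts [hcard K hS.1 h1, ih hS.2 h1]

end IsComponentFamily

lemma isDirectProdOfConjugates_iff_sSup {A N L : Subgroup H}
    (hN : centralizer (N : Set H) = ⊥) :
    IsDirectProdOfConjugates A N L ↔ sSup {K | ∃ a ∈ A, K = conjSub a L} = N ∧
      IsComponentFamily {K | ∃ a ∈ A, K = conjSub a L} := by
  constructor
  · rintro ⟨h1, h2, -⟩
    have h1 : sSup {K | ∃ a ∈ A, K = conjSub a L} = N := sSup_eq_iSup.trans h1
    exact ⟨h1, fun K hK K' => h2 K K' hK, by rwa [h1]⟩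
  · rintro ⟨h1, h2⟩
    refine ⟨sSup_eq_iSup.symm.trans h1, fun K K' hK hK' => h2.commute K hK K' hK',
      fun K hK => ?_⟩
    have h3 := h2.sSup_inf_sSup (Set.singleton_subset_iff.2 hK)
      (T := {K' | (∃ a ∈ A, K' = conjSub a L) ∧ K' ≠ K}) (fun K' hK' => hK'.1)
      (Set.disjoint_singleton_left.2 fun h => h.2 rfl)
    rwa [sSup_singleton, sSup_eq_iSup] at h3

lemma conjSub_subgroupOf {M : Subgroup H} (g : M) (K : Subgroup H) :
    conjSub g (K.subgroupOf M) = (conjSub (g : H) K).subgroupOf M := by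
  ext x
  simp [mem_conjSub, mem_subgroupOf]

lemma IsCoprimePair.subgroupOf {A N M : Subgroup H} (h : IsCoprimePair p A N) (hA : A ≤ M) :
    IsCoprimePair p (A.subgroupOf M) (N.subgroupOf M) where
  elem := ⟨fun a b => Subtype.ext (Subtype.ext (h.elem.mul_comm a.2 b.2)),
    fun a => Subtype.ext (Subtype.ext (h.elem.pow_eq_one a.2))⟩
  noncyclic := by
    obtain ⟨u, hu, v, hv, hu1, huv⟩ := h.noncyclic
    refine ⟨⟨u, hA hu⟩, hu, ⟨v, hA hv⟩, hv, fun h => hu1 (congrArg Subtype.val h), ?_⟩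
    rintro ⟨k, hk⟩
    exact huv ⟨k, congrArg Subtype.val hk⟩
  le_normalizer := fun a ha => mem_normalizer_iff.2 fun x =>
    mem_normalizer_iff.1 (h.le_normalizer ha) x
  not_dvd := fun hdvd => h.not_dvd
    (hdvd.trans (card_comap_dvd_of_injective N M.subtype M.subtype_injective))

lemma amalgamProp_of_subgroupOf {A N M : Subgroup H} (hA : A ≤ M) (hN : N ≤ M)
    (h : AmalgamProp (A.subgroupOf M) (N.subgroupOf M)) : AmalgamProp A N := by
  classical
  intro Γ _ φ hφ
  obtain ⟨ψ, hψ, hψφ⟩ := h Γ (fun x => φ x) fun a ha ha1 x hx y hy hax hay =>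
    hφ a ha (fun h => ha1 (Subtype.ext h)) x hx y hy (congrArg Subtype.val hax)
      (congrArg Subtype.val hay)
  have hval {x : H} (hx : x ∈ N) :
      (fun x => if h : x ∈ M then ψ ⟨x, h⟩ else 1) x = ψ ⟨x, hN hx⟩ := dif_pos (hN hx)
  refine ⟨fun x => if h : x ∈ M then ψ ⟨x, h⟩ else 1, fun x hx y hy => ?_,
    fun a ha ha1 x hx hax => ?_⟩
  · rw [hval hx, hval hy, hval (N.mul_mem hx hy)]
    exact hψ ⟨x, hN hx⟩ hx ⟨y, hN hy⟩ hy
  · rw [hval hx]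
    exact hψφ ⟨a, hA ha⟩ ha (fun h => ha1 (congrArg Subtype.val h)) ⟨x, hN hx⟩ hx
      (Subtype.ext hax)

/-- If `A` acts faithfully on the coprime group `N` with trivial center, then `N` has trivial
centralizer in `AN`. -/
lemma IsCoprimePair.centralizer_eq_bot [Fact p.Prime] [Finite H] {A N : Subgroup H}
    (h : IsCoprimePair p A N) (hsup : A ⊔ N = ⊤)
    (hZ : ∀ z ∈ N, (∀ x ∈ N, z * x = x * z) → z = 1)
    (hA : ∀ a ∈ A, (∀ x ∈ N, a * x = x * a) → a = 1) : centralizer (N : Set H) = ⊥ := by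
  have := h.normal hsup
  rw [eq_bot_iff]
  intro z hz
  have hz' : ∀ x ∈ N, z * x = x * z := fun x hx => (mem_centralizer_iff.1 hz x hx).symm
  have hpow : z ^ p ∈ N := by
    have hle : (⊤ : Subgroup H) ≤ A ⊔ N := hsup.ge
    obtain ⟨a, ha, n, hn, rfl⟩ := (Subgroup.mem_sup_of_normal_right).1 (hle (mem_top z))
    rw [← QuotientGroup.eq_one_iff, QuotientGroup.mk_pow, QuotientGroup.mk_mul,
      (QuotientGroup.eq_one_iff n).2 hn, mul_one, ← QuotientGroup.mk_pow, h.elem.pow_eq_one ha,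
      QuotientGroup.mk_one]
  have hzp : z ^ p = 1 := hZ _ hpow fun x hx => (Commute.pow_left (hz' x hx) p)
  by_contra hz1
  rw [mem_bot] at hz1
  have hE : zpowers z ∈ apSet p H := by
    refine ⟨by rwa [Ne, zpowers_eq_bot], ?_, ?_⟩
    · rintro ⟨_, i, rfl⟩ ⟨_, j, rfl⟩
      exact Subtype.ext (Commute.zpow_zpow_self z i j)
    · rintro ⟨_, i, rfl⟩
      refine Subtype.ext ?_
      change (z ^ i) ^ p = 1
      rw [← zpow_natCast, zpow_comm, zpow_natCast, hzp, one_zpow]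
  obtain ⟨n, hn, hle⟩ := h.exists_le_conjSub hsup hE
  have hzA := mem_conjSub.1 (hle (mem_zpowers z))
  rw [mul_assoc, hz' n hn, inv_mul_cancel_left] at hzA
  exact hz1 (hA z hzA hz')

/-- The set of `B`-conjugates of `K`. -/
def conjOrbit (B K : Subgroup H) : Set (Subgroup H) := {K' | ∃ b ∈ B, K' = conjSub b K}

lemma conjSub_mem_conjOrbit {B K : Subgroup H} : ∀ b ∈ B, ∀ K' ∈ conjOrbit B K,
    conjSub b K' ∈ conjOrbit B K := by
  rintro b hb _ ⟨c, hc, rfl⟩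
  exact ⟨b * c, B.mul_mem hb hc, conjSub_conjSub b c K⟩

lemma self_mem_conjOrbit (B K : Subgroup H) : K ∈ conjOrbit B K :=
  ⟨1, B.one_mem, (conjSub_one K).symm⟩

theorem aschbacherCore_subgroupOf [Fact p.Prime] [Finite H] {𝒦 : Set (Subgroup H)}
    (h𝒦 : IsComponentFamily 𝒦) {B K : Subgroup H} (hO : conjOrbit B K ⊆ 𝒦)
    (hB : IsCoprimePair p B (sSup (conjOrbit B K)))
    (hK : IsSimpleGroup K) (hK' : ∃ a b : K, a * b ≠ b * a)
    (hfaith : ∀ b ∈ B, (∀ x ∈ sSup (conjOrbit B K), b * x = x * b) → b = 1) :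
    AschbacherCore p (B.subgroupOf (B ⊔ sSup (conjOrbit B K)))
      ((sSup (conjOrbit B K)).subgroupOf (B ⊔ sSup (conjOrbit B K)))
      (K.subgroupOf (B ⊔ sSup (conjOrbit B K))) := by
  set N := sSup (conjOrbit B K) with hN
  set M := B ⊔ N with hM
  have hBM : B ≤ M := le_sup_left
  have hNM : N ≤ M := le_sup_right
  have hKN : K ≤ N := le_sSup (self_mem_conjOrbit B K)
  have hpair := hB.subgroupOf hBM
  have hsup : B.subgroupOf M ⊔ N.subgroupOf M = ⊤ := by
    rw [← subgroupOf_sup hBM hNM, subgroupOf_self]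
  have hnormal := hpair.normal hsup
  have hcent : centralizer (N.subgroupOf M : Set M) = ⊥ := by
    refine hpair.centralizer_eq_bot hsup (fun z hz hzN => Subtype.ext ?_)
      fun a ha haN => Subtype.ext ?_
    · exact h𝒦.eq_one_of_mem_of_commute hO hz fun x hx =>
        congrArg Subtype.val (hzN ⟨x, hNM hx⟩ hx)
    · exact hfaith a ha fun x hx => congrArg Subtype.val (haN ⟨x, hNM hx⟩ hx)
  let e : K.subgroupOf M ≃* K := subgroupOfEquivOfLe (hKN.trans hNM)
  have hNK : N ≤ normalizer (K : Set H) := sSup_le fun K' hK' x hx => by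
    by_cases heq : K' = K
    · exact le_normalizer (heq ▸ hx)
    · exact centralizer_le_normalizer _ (mem_centralizer_iff.2 fun y hy => (h𝒦.commute K'
        (hO hK') K (hO (self_mem_conjOrbit B K)) heq x hx y hy).symm)
  refine ⟨hpair.elem, hnormal, hcent, hsup, fun x hx => hKN hx, ?_, ?_, ?_, ?_, ?_⟩
  · refine ⟨2, fun i => if i = 0 then K.subgroupOf M else if i = 1 then N.subgroupOf M else ⊤,
      rfl, rfl, fun i hi => ?_⟩
    interval_cases i
    · exact ⟨fun x hx => hKN hx, fun g hg x hx => (mem_normalizer_iff.1 (hNK hg) x).1 hx⟩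
    · exact ⟨le_top, fun g _ x hx => hnormal.conj_mem x hx g⟩
  · exact e.isSimpleGroup_congr.2 hK
  · obtain ⟨a, b, hab⟩ := hK'
    refine ⟨e.symm a, e.symm b, ?_⟩
    rwa [← map_mul, ← map_mul, e.symm.injective.ne_iff]
  · intro hdvd
    exact hpair.not_dvd (hdvd.trans (card_dvd_of_le fun x hx => hKN hx))
  · have hmem (a : M) (ha : a ∈ B.subgroupOf M) : conjSub (a : H) K ∈ conjOrbit B K := ⟨a, ha, rfl⟩
    have hS : sSup {K' | ∃ a ∈ B.subgroupOf M, K' = conjSub a (K.subgroupOf M)}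
        = N.subgroupOf M := by
      refine le_antisymm (sSup_le ?_) ?_
      · rintro _ ⟨a, ha, rfl⟩
        rw [conjSub_subgroupOf]
        exact fun x hx => (le_sSup (hmem a ha) : _ ≤ N) hx
      · have hle : N ≤ (sSup {K' | ∃ a ∈ B.subgroupOf M,
            K' = conjSub a (K.subgroupOf M)}).map M.subtype := by
          refine sSup_le ?_
          rintro _ ⟨b, hb, rfl⟩ x hx
          have hxM : x ∈ M := hNM ((le_sSup (hmem ⟨b, hBM hb⟩ hb) : _ ≤ N) hx)
          have h1 : (⟨x, hxM⟩ : M) ∈ conjSub ⟨b, hBM hb⟩ (K.subgroupOf M) := by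
            rw [conjSub_subgroupOf]
            exact hx
          have h2 : conjSub ⟨b, hBM hb⟩ (K.subgroupOf M) ≤
              sSup {K' | ∃ a ∈ B.subgroupOf M, K' = conjSub a (K.subgroupOf M)} :=
            le_sSup ⟨⟨b, hBM hb⟩, hb, rfl⟩
          exact ⟨⟨x, hxM⟩, h2 h1, rfl⟩
        intro x hx
        obtain ⟨y, hy, hyx⟩ := hle hx
        rwa [← M.subtype_injective hyx]
    refine (isDirectProdOfConjugates_iff_sSup hcent).2 ⟨hS, ?_, by rw [hS, hcent]⟩
    rintro _ ⟨a, ha, rfl⟩ _ ⟨b, hb, rfl⟩ hne x hx y hy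
    rw [conjSub_subgroupOf] at hx hy
    refine Subtype.ext (h𝒦.commute _ (hO (hmem a ha)) _ (hO (hmem b hb)) (fun heq => hne ?_)
      x hx y hy)
    rw [conjSub_subgroupOf, conjSub_subgroupOf, heq]

theorem amalgamProp_conjOrbit [Fact p.Prime] [Finite H] {L₀ : Type} [Group L₀]
    (hyp : ∀ (H : Type) [Group H] [Finite H] (A N L : Subgroup H), AschbacherCore p A N L →
      Nonempty (L ≃* L₀) → Nat.card A = p ^ 3 → SimplyConnectedSpace (geomRealOn (apSet p H)))
    {𝒦 : Set (Subgroup H)} (h𝒦 : IsComponentFamily 𝒦) {B K : Subgroup H}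
    (hO : conjOrbit B K ⊆ 𝒦) (hB : IsCoprimePair p B (sSup (conjOrbit B K)))
    (hcard : Nat.card B = p ^ 3) (hK : IsSimpleGroup K) (hK' : ∃ a b : K, a * b ≠ b * a)
    (e : K ≃* L₀) : AmalgamProp B (sSup (conjOrbit B K)) := by
  by_cases hfaith : ∀ b ∈ B, (∀ x ∈ sSup (conjOrbit B K), b * x = x * b) → b = 1
  · have hcore := aschbacherCore_subgroupOf h𝒦 hO hB hK hK' hfaith
    have hle : K ≤ B ⊔ sSup (conjOrbit B K) :=
      (le_sSup (self_mem_conjOrbit B K)).trans le_sup_right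
    refine amalgamProp_of_subgroupOf le_sup_left le_sup_right
      ((hB.subgroupOf le_sup_left).amalgamProp_of_cocyclesTrivial hcore.2.2.2.1
        (cocyclesTrivial_of_simplyConnected (hyp _ _ _ _ hcore
          ⟨(subgroupOfEquivOfLe hle).trans e⟩ ?_)))
    rw [Nat.card_congr (subgroupOfEquivOfLe le_sup_left).toEquiv, hcard]
  · push Not at hfaith
    obtain ⟨b, hb, hbN, hb1⟩ := hfaith
    exact amalgamProp_of_commute hb hb1 hbN

theorem amalgamProp_sSup [hp : Fact p.Prime] [Finite H] {L₀ : Type} [Group L₀] [IsSimpleGroup L₀]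
    (hL₀ : ∃ a b : L₀, a * b ≠ b * a) (hpL₀ : ¬ p ∣ Nat.card L₀)
    (hyp : ∀ (H : Type) [Group H] [Finite H] (A N L : Subgroup H), AschbacherCore p A N L →
      Nonempty (L ≃* L₀) → Nat.card A = p ^ 3 → SimplyConnectedSpace (geomRealOn (apSet p H)))
    {𝒦 : Set (Subgroup H)} (h𝒦 : IsComponentFamily 𝒦) (h𝒦L₀ : ∀ K ∈ 𝒦, Nonempty (K ≃* L₀))
    {B : Subgroup H} (hB : IsElementaryAbelian p B) (hcard : Nat.card B = p ^ 3)
    {S : Set (Subgroup H)} (hS : S ⊆ 𝒦) (hBS : ∀ b ∈ B, ∀ K ∈ S, conjSub b K ∈ S) :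
    AmalgamProp B (sSup S) := by
  have hlt {k : ℕ} (hk : k < 3) : p ^ k < Nat.card B := by
    rw [hcard]
    exact Nat.pow_lt_pow_right hp.out.one_lt hk
  have hnc := hB.exists_noncyclic (by simpa using hlt (k := 1) (by simp))
  have hpair {T : Set (Subgroup H)} (hT : T ⊆ 𝒦) (hBT : ∀ b ∈ B, ∀ K ∈ T, conjSub b K ∈ T) :
      IsCoprimePair p B (sSup T) := by
    refine ⟨hB, hnc, le_normalizer_sSup hBT, h𝒦.not_dvd_card_sSup (fun K hK => ?_) hT⟩
    obtain ⟨e⟩ := h𝒦L₀ K hK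
    rwa [Nat.card_congr e.toEquiv]
  induction hn : S.ncard using Nat.strong_induction_on generalizing S with
  | _ n ih =>
    subst hn
    obtain rfl | ⟨K, hK⟩ := S.eq_empty_or_nonempty
    · obtain ⟨u, hu, -, -, hu1, -⟩ := hnc
      refine amalgamProp_of_commute hu hu1 fun x hx => ?_
      rw [sSup_empty, mem_bot] at hx
      rw [hx, mul_one, one_mul]
    · have hOS : conjOrbit B K ⊆ S := by
        rintro _ ⟨b, hb, rfl⟩
        exact hBS b hb K hK
      have hBT : ∀ b ∈ B, ∀ K' ∈ S \ conjOrbit B K, conjSub b K' ∈ S \ conjOrbit B K := by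
        refine fun b hb K' hK' => ⟨hBS b hb K' hK'.1, fun h => hK'.2 ?_⟩
        simpa [conjSub_conjSub] using conjSub_mem_conjOrbit b⁻¹ (B.inv_mem hb) _ h
      have hTlt : (S \ conjOrbit B K).ncard < S.ncard :=
        Set.ncard_lt_ncard ⟨Set.sdiff_subset, fun h => (h hK).2 (self_mem_conjOrbit B K)⟩
      have hTS : S \ conjOrbit B K ⊆ 𝒦 := Set.sdiff_subset.trans hS
      have hsup : sSup S = sSup (conjOrbit B K) ⊔ sSup (S \ conjOrbit B K) := by
        rw [← sSup_union, Set.union_sdiff_cancel hOS]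
      obtain ⟨e⟩ := h𝒦L₀ K (hS hK)
      obtain ⟨a, b, hab⟩ := hL₀
      have hpO := hpair (hOS.trans hS) conjSub_mem_conjOrbit
      rw [hsup]
      refine AmalgamProp.sup hpO (hpair hTS hBT) (hlt (k := 2) (by simp))
        (h𝒦.commute_sSup (hOS.trans hS) hTS Set.disjoint_sdiff_right)
        (h𝒦.sSup_inf_sSup (hOS.trans hS) hTS Set.disjoint_sdiff_right)
        (amalgamProp_conjOrbit hyp h𝒦 (hOS.trans hS) hpO hcard e.isSimpleGroup
          ⟨e.symm a, e.symm b, ?_⟩ e) (ih _ hTlt hTS hBT rfl)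
      rwa [← map_mul, ← map_mul, e.symm.injective.ne_iff]

theorem simplyConnected_of_rank_three [hp : Fact p.Prime] [Finite H] {A N L : Subgroup H}
    (h : AschbacherCore p A N L) {r : ℕ} (hr : 3 ≤ r) (hcard : Nat.card A = p ^ r)
    (hyp : ∀ (H' : Type) [Group H'] [Finite H'] (A' N' L' : Subgroup H'),
      AschbacherCore p A' N' L' → Nonempty (L' ≃* L) → Nat.card A' = p ^ 3 →
      SimplyConnectedSpace (geomRealOn (apSet p H'))) :
    SimplyConnectedSpace (geomRealOn (apSet p H)) := by
  obtain ⟨hA, hnormal, hcent, hsup, -, -, hL, hL', hpL, hprod⟩ := h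
  obtain ⟨hN, h𝒦⟩ := (isDirectProdOfConjugates_iff_sSup hcent).1 hprod
  have h𝒦L : ∀ K ∈ {K | ∃ a ∈ A, K = conjSub a L}, Nonempty (K ≃* L) := by
    rintro _ ⟨a, -, rfl⟩
    exact ⟨(L.equivMapOfInjective _ (MulAut.conj a).injective).symm⟩
  have hpN : ¬ p ∣ Nat.card N := by
    rw [← hN]
    refine h𝒦.not_dvd_card_sSup (fun K hK => ?_) subset_rfl
    obtain ⟨e⟩ := h𝒦L K hK
    rwa [Nat.card_congr e.toEquiv]
  obtain ⟨B₀, hB₀⟩ := Sylow.exists_subgroup_card_pow_prime (G := A) p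
    (hcard ▸ pow_dvd_pow p hr)
  have hBA : B₀.map A.subtype ≤ A := map_subtype_le B₀
  have hBcard : Nat.card (B₀.map A.subtype) = p ^ 3 := by
    rw [← hB₀, card_map_of_injective A.subtype_injective]
  have hlt : p < p ^ 3 := by simpa using Nat.pow_lt_pow_right hp.out.one_lt (show 1 < 3 by simp)
  have hle : (⊤ : Subgroup H) ≤ normalizer (N : Set H) := (normalizer_eq_top N).ge
  have hpair : IsCoprimePair p A N := ⟨hA, hA.exists_noncyclic
    (hcard ▸ hlt.trans_le (Nat.pow_le_pow_right hp.out.pos hr)), le_top.trans hle, hpN⟩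
  have hpairB : IsCoprimePair p (B₀.map A.subtype) N := ⟨hA.mono hBA,
    (hA.mono hBA).exists_noncyclic (hBcard ▸ hlt), le_top.trans hle, hpN⟩
  have hamalg : AmalgamProp (B₀.map A.subtype) N := by
    rw [← hN]
    refine amalgamProp_sSup hL' hpL hyp h𝒦 h𝒦L (hA.mono hBA) hBcard subset_rfl ?_
    rintro b hb _ ⟨a, ha, rfl⟩
    exact ⟨b * a, A.mul_mem (hBA hb) ha, conjSub_conjSub b a L⟩
  exact simplyConnected_of_cocyclesTrivial ⟨A, hpair.mem_apSet⟩ (hpair.eqvGen_apSet hsup)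
    (hpair.cocyclesTrivial_of_amalgamProp hsup (hpairB.amalgamProp_of_le hBA hA hamalg))

end Amalgam

/-- If Aschbacher's conjecture at `p` holds for all rank-3 instances,
then it holds for all instances of rank `r ≥ 3`; moreover, for a fixed nonabelian
simple group `L₀` of order prime to `p`, if the conjecture holds for all rank-3
instances with simple component `L₀` then it holds for all instances of rank `r ≥ 3`
with simple component `L₀`. -/
theorem stmt4 (p : ℕ) (hp : p.Prime) :
    (AschbacherConjectureRank p (· = 3) → AschbacherConjectureRank p (fun _ => True)) ∧
    (∀ (L₀ : Type) [Group L₀] [Finite L₀], IsSimpleGroup L₀ → (∃ a b : L₀, a * b ≠ b * a) →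
      ¬ p ∣ Nat.card L₀ →
      AschbacherConjectureRankFor p (· = 3) L₀ →
      AschbacherConjectureRankFor p (fun _ => True) L₀) := by
  have : Fact p.Prime := ⟨hp⟩
  refine ⟨fun hyp H _ _ A N L h ⟨r, hr, _, hcard⟩ => ?_,
    fun L₀ _ _ _ _ _ hyp H _ _ A N L h ⟨e⟩ ⟨r, hr, _, hcard⟩ => ?_⟩
  · exact simplyConnected_of_rank_three h hr hcard fun H' _ _ A' N' L' h' _ hcard' =>
      hyp H' A' N' L' h' ⟨3, le_rfl, rfl, hcard'⟩
  · exact simplyConnected_of_rank_three h hr hcard fun H' _ _ A' N' L' h' ⟨e'⟩ hcard' =>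
      hyp H' A' N' L' h' ⟨e'.trans e⟩ ⟨3, le_rfl, rfl, hcard'⟩
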